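/- arXiv:math/0507420 — 10 statements merged into one kernel-verified Lean document; each statement's English description precedes it below -/
import Mathlib

section
/- Let N(ω) = #{i ∈ I : p_i(ω) ≤ kα/s} be the number of true null hypotheses rejected by the single-step procedure that rejects H_i when p_i ≤ kα/s. Then P{N ≥ k} ≤ α; that is, the single-step procedure with common cutoff kα/s controls the k-FWER at level α. -/
open MeasureTheory Set

/-- Markov's inequality for the number of events that occur among a finite family. -/
theorem mul_measure_le_card_filter_le_sum {Ω ι : Type*} [MeasurableSpace Ω] (P : Measure Ω)
    (I : Finset ι) (q : ι → Ω → Prop) [∀ ω, DecidablePred fun i => q i ω]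
    (hq : ∀ i ∈ I, MeasurableSet {ω | q i ω}) (k : ℕ) :
    (k : ENNReal) * P {ω | k ≤ (I.filter (fun i => q i ω)).card} ≤ ∑ i ∈ I, P {ω | q i ω} := by
  have hcard : ∀ ω, ((I.filter (fun i => q i ω)).card : ENNReal)
      = ∑ i ∈ I, {ω | q i ω}.indicator 1 ω := by
    intro ω
    simp [Set.indicator_apply]
  have hind : ∀ i ∈ I, Measurable ({ω | q i ω}.indicator (1 : Ω → ENNReal)) :=
    fun i hi => measurable_one.indicator (hq i hi)
  calc (k : ENNReal) * P {ω | k ≤ (I.filter (fun i => q i ω)).card}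
      = k * P {ω | (k : ENNReal) ≤ ∑ i ∈ I, {ω | q i ω}.indicator 1 ω} := by
        simp_rw [← hcard, Nat.cast_le]
    _ ≤ ∫⁻ ω, ∑ i ∈ I, {ω | q i ω}.indicator 1 ω ∂P :=
        mul_meas_ge_le_lintegral (Finset.measurable_fun_sum I hind) _
    _ = ∑ i ∈ I, P {ω | q i ω} := by
        rw [lintegral_finsetSum I hind]
        exact Finset.sum_congr rfl fun i hi => lintegral_indicator_one (hq i hi)

/-- Theorem 2.1(i) of Lehmann–Romano: the single-step procedure rejecting `H_i`
when `p_i ≤ kα/s` controls the `k`-FWER at level `α`. -/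
theorem singleStep_controls_kFWER
    {Ω : Type*} [MeasurableSpace Ω] (P : Measure Ω) [IsProbabilityMeasure P]
    (s : ℕ) (hs : 1 ≤ s) (p : Fin s → Ω → ℝ)
    (hmeas : ∀ i, Measurable (p i)) (hrange : ∀ i ω, p i ω ∈ Set.Icc (0:ℝ) 1)
    (I : Finset (Fin s))
    (hI : ∀ i ∈ I, ∀ u ∈ Set.Ioo (0:ℝ) 1, P {ω | p i ω ≤ u} ≤ ENNReal.ofReal u)
    (k : ℕ) (hk1 : 1 ≤ k) (hks : k ≤ s) (α : ℝ) (hα : α ∈ Set.Ioo (0:ℝ) 1) :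
    P {ω | k ≤ (I.filter (fun i => p i ω ≤ (k : ℝ) * α / (s : ℝ))).card}
      ≤ ENNReal.ofReal α := by
  have hs0 : (0 : ℝ) < s := by exact_mod_cast hs
  have hk0 : (0 : ℝ) < k := by exact_mod_cast hk1
  have hks' : (k : ℝ) ≤ s := by exact_mod_cast hks
  have hu : (k : ℝ) * α / s ∈ Set.Ioo (0 : ℝ) 1 := by
    refine ⟨div_pos (mul_pos hk0 hα.1) hs0, (div_lt_one hs0).2 ?_⟩
    nlinarith [hα.2]
  have hkE : (k : ENNReal) ≠ 0 := by exact_mod_cast (Nat.one_le_iff_ne_zero.1 hk1)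
  refine (ENNReal.mul_le_mul_iff_right hkE (ENNReal.natCast_ne_top k)).1 ?_
  calc _ ≤ ∑ i ∈ I, P {ω | p i ω ≤ (k : ℝ) * α / s} :=
        mul_measure_le_card_filter_le_sum P I (fun i ω => p i ω ≤ (k : ℝ) * α / s)
          (fun i _ => measurableSet_le (hmeas i) measurable_const) k
    _ ≤ ∑ _i ∈ I, ENNReal.ofReal ((k : ℝ) * α / s) :=
        Finset.sum_le_sum fun i hi => hI i hi _ hu
    _ ≤ (s : ENNReal) * ENNReal.ofReal ((k : ℝ) * α / s) := by
        rw [Finset.sum_const, nsmul_eq_mul]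
        gcongr
        simpa using I.card_le_univ
    _ = k * ENNReal.ofReal α := by
        rw [← ENNReal.ofReal_natCast s, ← ENNReal.ofReal_natCast k,
          ← ENNReal.ofReal_mul hs0.le, ← ENNReal.ofReal_mul hk0.le, mul_div_cancel₀ _ hs0.ne']
end

section
/- For every integer k with 1 ≤ k ≤ s and every α ∈ (0,1), there exist a probability space (Ω, 𝓕, P) and measurable random variables p_1, …, p_s : Ω → [0,1], each marginally uniformly distributed on (0,1), such that P{#{i : p_i ≤ kα/s} ≥ k} = α. Hence the bound k-FWER ≤ α for the single-step procedure with cutoff kα/s is sharp when all s hypotheses are true. -/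
open MeasureTheory Set

/-- The quantile function of the law with mass `a` spread uniformly over `[0, c]` and
mass `1 - a` spread uniformly over `[c, 1]`. -/
noncomputable def twoBlockQuantile (c a x : ℝ) : ℝ :=
  if x ≤ a then c * x / a else c + (1 - c) * (x - a) / (1 - a)

/-- The distribution function on `[0, 1]` of the law described in `twoBlockQuantile`. -/
noncomputable def twoBlockCDF (c a u : ℝ) : ℝ :=
  if u < c then a * u / c else a + (1 - a) * (u - c) / (1 - c)

section TwoBlock

variable {c a u x : ℝ}

theorem measurable_twoBlockQuantile : Measurable (twoBlockQuantile c a) :=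
  Measurable.ite measurableSet_Iic (by fun_prop) (by fun_prop)

theorem twoBlockQuantile_le_iff_le (hc : c ∈ Ioo (0 : ℝ) 1) (ha : a ∈ Ico (0 : ℝ) 1) :
    twoBlockQuantile c a x ≤ c ↔ x ≤ a := by
  obtain ⟨hc0, hc1⟩ := hc
  obtain ⟨ha0, ha1⟩ := ha
  unfold twoBlockQuantile
  split_ifs with h
  · refine iff_of_true ?_ h
    exact div_le_of_le_mul₀ ha0 hc0.le (mul_le_mul_of_nonneg_left h hc0.le)
  · refine iff_of_false (not_le.2 ?_) h
    have : 0 < (1 - c) * (x - a) / (1 - a) :=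
      div_pos (mul_pos (by linarith) (by linarith)) (by linarith)
    linarith

theorem twoBlockQuantile_mem_Icc (hc : c ∈ Ioo (0 : ℝ) 1) (ha : a ∈ Ico (0 : ℝ) 1)
    (hx : x ∈ Icc (0 : ℝ) 1) : twoBlockQuantile c a x ∈ Icc (0 : ℝ) 1 := by
  have hle := twoBlockQuantile_le_iff_le (x := x) hc ha
  obtain ⟨hc0, hc1⟩ := hc
  obtain ⟨ha0, ha1⟩ := ha
  obtain ⟨hx0, hx1⟩ := hx
  by_cases h : x ≤ a
  · refine ⟨?_, (hle.2 h).trans hc1.le⟩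
    rw [twoBlockQuantile, if_pos h]
    positivity
  · refine ⟨hc0.le.trans (le_of_not_ge (mt hle.1 h)), ?_⟩
    rw [twoBlockQuantile, if_neg h]
    have : (1 - c) * (x - a) / (1 - a) ≤ 1 - c := by
      rw [div_le_iff₀ (by linarith)]
      exact mul_le_mul_of_nonneg_left (by linarith) (by linarith)
    linarith

theorem twoBlockQuantile_le_iff (hc : c ∈ Ioo (0 : ℝ) 1) (ha : a ∈ Ico (0 : ℝ) 1)
    (hu : 0 ≤ u) : twoBlockQuantile c a x ≤ u ↔ x ≤ twoBlockCDF c a u := by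
  have hle := twoBlockQuantile_le_iff_le (x := x) hc ha
  obtain ⟨hc0, hc1⟩ := hc
  obtain ⟨ha0, ha1⟩ := ha
  unfold twoBlockCDF
  split_ifs with huc
  · have hcdf : a * u / c ≤ a := by
      rw [div_le_iff₀ hc0]
      exact mul_le_mul_of_nonneg_left huc.le ha0
    by_cases h : x ≤ a
    · rw [twoBlockQuantile, if_pos h]
      rcases ha0.eq_or_lt with rfl | ha0
      · simpa [hu] using h
      · rw [div_le_iff₀ ha0, le_div_iff₀ hc0, mul_comm c, mul_comm u]
    · exact iff_of_false (fun H => h (hle.1 (H.trans huc.le))) (fun H => h (H.trans hcdf))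
  · push Not at huc
    by_cases h : x ≤ a
    · have : 0 ≤ (1 - a) * (u - c) / (1 - c) :=
        div_nonneg (mul_nonneg (by linarith) (by linarith)) (by linarith)
      exact iff_of_true ((hle.2 h).trans huc) (by linarith)
    · rw [twoBlockQuantile, if_neg h, ← le_sub_iff_add_le', ← sub_le_iff_le_add',
        div_le_iff₀ (by linarith), le_div_iff₀ (by linarith), mul_comm (1 - c),
        mul_comm (1 - a)]

theorem twoBlockCDF_mem_Icc (hc : c ∈ Ioo (0 : ℝ) 1) (ha : a ∈ Ico (0 : ℝ) 1)
    (hu : u ∈ Icc (0 : ℝ) 1) : twoBlockCDF c a u ∈ Icc (0 : ℝ) 1 := by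
  obtain ⟨hc0, hc1⟩ := hc
  obtain ⟨ha0, ha1⟩ := ha
  obtain ⟨hu0, hu1⟩ := hu
  unfold twoBlockCDF
  split_ifs with huc
  · refine ⟨by positivity, ?_⟩
    rw [div_le_one hc0]
    nlinarith
  · push Not at huc
    have h0 : 0 ≤ (1 - a) * (u - c) / (1 - c) :=
      div_nonneg (mul_nonneg (by linarith) (by linarith)) (by linarith)
    have h1 : (1 - a) * (u - c) / (1 - c) ≤ 1 - a := by
      rw [div_le_iff₀ (by linarith)]
      exact mul_le_mul_of_nonneg_left (by linarith) (by linarith)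
    exact ⟨by linarith, by linarith⟩

/-- Averaging the two-block laws over weights with mean `c` gives the uniform law. -/
theorem sum_twoBlockCDF {ι : Type*} [Fintype ι] (hc : c ∈ Ioo (0 : ℝ) 1) (w : ι → ℝ)
    (hw : ∑ m, w m = Fintype.card ι * c) :
    ∑ m, twoBlockCDF c (w m) u = Fintype.card ι * u := by
  have hc0 : c ≠ 0 := hc.1.ne'
  have hc1 : 1 - c ≠ 0 := (sub_pos.2 hc.2).ne'
  unfold twoBlockCDF
  split_ifs with huc
  · rw [← Finset.sum_div, ← Finset.sum_mul, hw]
    field_simp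
  · rw [Finset.sum_add_distrib, ← Finset.sum_div, ← Finset.sum_mul, Finset.sum_sub_distrib, hw]
    simp only [Finset.sum_const, Finset.card_univ, nsmul_eq_mul, mul_one]
    field_simp
    ring

end TwoBlock

theorem unitInterval.volume_setOf_coe_le {t : ℝ} (ht : t ∈ Icc (0 : ℝ) 1) :
    volume {x : unitInterval | (x : ℝ) ≤ t} = ENNReal.ofReal t :=
  unitInterval.volume_Iic ⟨t, ht⟩

/-- The product of the uniform probability measures on `Fin s` and on the unit interval. -/
noncomputable def uniformFinProdUnitInterval (s : ℕ) : Measure (Fin s × unitInterval) :=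
  ((s : ENNReal)⁻¹ • Measure.count).prod volume

theorem uniformFinProdUnitInterval_apply {s : ℕ} {A : Set (Fin s × unitInterval)}
    (hA : MeasurableSet A) :
    uniformFinProdUnitInterval s A =
      (s : ENNReal)⁻¹ * ∑ j, volume {x : unitInterval | (j, x) ∈ A} := by
  rw [uniformFinProdUnitInterval, Measure.prod_apply hA, lintegral_smul_measure,
    lintegral_count, tsum_fintype, smul_eq_mul]
  rfl

/-- If each fibre is an initial segment of the unit interval, the measure of the whole set is
the average length of the segments. -/
theorem uniformFinProdUnitInterval_setOf_le {s : ℕ} (hs : 0 < s) {t : Fin s → ℝ} {v : ℝ}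
    (ht : ∀ j, t j ∈ Icc (0 : ℝ) 1) (hv : ∑ j, t j = s * v) :
    uniformFinProdUnitInterval s {ω | (ω.2 : ℝ) ≤ t ω.1} = ENNReal.ofReal v := by
  have hA : MeasurableSet {ω : Fin s × unitInterval | (ω.2 : ℝ) ≤ t ω.1} :=
    measurableSet_le (by fun_prop) ((measurable_of_finite t).comp measurable_fst)
  rw [uniformFinProdUnitInterval_apply hA]
  simp only [mem_ofPred_eq, unitInterval.volume_setOf_coe_le (ht _)]
  rw [← ENNReal.ofReal_sum_of_nonneg fun j _ => (ht j).1, hv,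
    ENNReal.ofReal_mul (Nat.cast_nonneg s), ENNReal.ofReal_natCast, ← mul_assoc,
    ENNReal.inv_mul_cancel (by exact_mod_cast hs.ne') (ENNReal.natCast_ne_top s), one_mul]

theorem isProbabilityMeasure_uniformFinProdUnitInterval {s : ℕ} (hs : 0 < s) :
    IsProbabilityMeasure (uniformFinProdUnitInterval s) := by
  constructor
  have h := uniformFinProdUnitInterval_setOf_le hs (t := fun _ => 1) (v := 1) (by simp) (by simp)
  rw [ENNReal.ofReal_one] at h
  rw [← h]
  congr 1
  ext ω
  simp [ω.2.2.2]

theorem card_filter_val_add_lt {s k : ℕ} [NeZero s] (hks : k ≤ s) (j : Fin s) :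
    (Finset.univ.filter fun i : Fin s => (i + j : Fin s).val < k).card = k := by
  rw [Finset.card_equiv (t := Finset.univ.filter fun m : Fin s => m.val < k)
    (Equiv.addRight j) (by simp), Fin.card_filter_val_lt, min_eq_right hks]

/-- Theorem 2.1(ii) of Lehmann–Romano: sharpness of the `k`-FWER bound for the
single-step procedure with cutoff `kα/s`. There is a joint distribution of
`s` marginally `U(0,1)` p-values for which the probability of at least `k`
of them being `≤ kα/s` is exactly `α`. -/
theorem singleStep_kFWER_sharp
    (s k : ℕ) (hk1 : 1 ≤ k) (hks : k ≤ s) (α : ℝ) (hα : α ∈ Set.Ioo (0:ℝ) 1) :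
    ∃ (Ω : Type) (inst : MeasurableSpace Ω) (P : Measure Ω)
      (instP : IsProbabilityMeasure P) (p : Fin s → Ω → ℝ),
      (∀ i, Measurable (p i)) ∧
      (∀ i ω, p i ω ∈ Set.Icc (0:ℝ) 1) ∧
      (∀ i, ∀ u ∈ Set.Ioo (0:ℝ) 1, P {ω | p i ω ≤ u} = ENNReal.ofReal u) ∧
      P {ω | k ≤ (Finset.univ.filter
          (fun i : Fin s => p i ω ≤ (k : ℝ) * α / (s : ℝ))).card}
        = ENNReal.ofReal α := by
  obtain ⟨hα0, hα1⟩ := hα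
  have hs : 0 < s := by omega
  have : NeZero s := ⟨hs.ne'⟩
  have hsR : (0 : ℝ) < s := by exact_mod_cast hs
  have hkR : (0 : ℝ) < k := by exact_mod_cast hk1
  have hksR : (k : ℝ) ≤ s := by exact_mod_cast hks
  set c : ℝ := (k : ℝ) * α / (s : ℝ) with hcdef
  have hc : c ∈ Ioo (0 : ℝ) 1 := by
    refine ⟨by positivity, ?_⟩
    rw [hcdef, div_lt_one hsR]
    nlinarith
  let w : Fin s → ℝ := fun m => if m.val < k then α else 0
  have hw : ∀ m, w m ∈ Ico (0 : ℝ) 1 := by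
    intro m
    dsimp only [w]
    split_ifs
    exacts [⟨hα0.le, hα1⟩, ⟨le_rfl, one_pos⟩]
  have hwsum : ∑ m, w m = Fintype.card (Fin s) * c := by
    simp only [w]
    rw [← Finset.sum_filter, Finset.sum_const, Fin.card_filter_val_lt, min_eq_right hks,
      Fintype.card_fin, nsmul_eq_mul, hcdef]
    field_simp
  refine ⟨Fin s × unitInterval, inferInstance, uniformFinProdUnitInterval s,
    isProbabilityMeasure_uniformFinProdUnitInterval hs,
    fun i ω => twoBlockQuantile c (w (i + ω.1)) ω.2, fun i => ?_, fun i ω => ?_,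
    fun i u hu => ?_, ?_⟩
  · refine measurable_from_prod_countable_right fun j => ?_
    exact (measurable_twoBlockQuantile (c := c) (a := w (i + j))).comp measurable_subtype_coe
  · exact twoBlockQuantile_mem_Icc hc (hw _) ω.2.2
  · simp only [twoBlockQuantile_le_iff hc (hw _) hu.1.le]
    refine uniformFinProdUnitInterval_setOf_le hs (t := fun j => twoBlockCDF c (w (i + j)) u)
      (fun j => twoBlockCDF_mem_Icc hc (hw _) (Ioo_subset_Icc_self hu)) ?_
    refine (Equiv.sum_comp (Equiv.addLeft i) fun m => twoBlockCDF c (w m) u).trans ?_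
    rw [sum_twoBlockCDF hc w hwsum, Fintype.card_fin]
  · simp only [twoBlockQuantile_le_iff_le hc (hw _)]
    rw [← uniformFinProdUnitInterval_setOf_le hs (t := fun _ => α) (v := α)
      (fun _ => ⟨hα0.le, hα1.le⟩) (by simp)]
    congr 1
    ext ⟨j, x⟩
    simp only [mem_ofPred_eq]
    constructor
    · intro h
      obtain ⟨i, hi⟩ := Finset.card_pos.1 (hk1.trans h)
      refine (Finset.mem_filter.1 hi).2.trans ?_
      dsimp only [w]
      split_ifs
      exacts [le_rfl, hα0.le]
    · intro hx
      rw [← card_filter_val_add_lt hks j]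
      refine Finset.card_le_card fun i hi => ?_
      rw [Finset.mem_filter] at hi ⊢
      exact ⟨hi.1, by simpa only [w, if_pos hi.2] using hx⟩
end

section
/- Fix an integer k ≥ 1, u ∈ (0,1], and constants 0 < β_1 ≤ β_2 ≤ ⋯ ≤ β_k ≤ u such that j(β_j − β_{j−1})/β_j ≤ 1 for every j = 2, …, k. Then there exist a probability space and random variables q_1, …, q_k, each marginally uniformly distributed on (0,u), whose ordered values q_(1) ≤ ⋯ ≤ q_(k) satisfy P{q_(1) ≤ β_1, q_(2) ≤ β_2, …, q_(k) ≤ β_k} = β_k/u. -/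
open MeasureTheory Set

/-- The `i`-th smallest element (0-indexed) of a multiset of reals. -/
noncomputable def orderStat (l : Multiset ℝ) (i : ℕ) : ℝ :=
  (l.sort (· ≤ ·)).getD i 0

/-- A lower bound for the number of elements below a threshold bounds an order statistic. -/
lemma orderStat_le_of_card {n j : ℕ} (x : Fin n → ℝ) (b : ℝ) (hj : 1 ≤ j) (s : Finset (Fin n))
    (hs : j ≤ s.card) (hb : ∀ i ∈ s, x i ≤ b) :
    orderStat (Multiset.map x Finset.univ.val) (j - 1) ≤ b := by
  unfold orderStat
  set m : Multiset ℝ := Multiset.map x Finset.univ.val with hm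
  have hlen : (m.sort (· ≤ ·)).length = n := by simp [hm]
  have hsn : s.card ≤ n := by simpa using s.card_le_univ
  have hjn : j - 1 < (m.sort (· ≤ ·)).length := by omega
  rw [List.getD_eq_getElem _ _ hjn]
  by_contra! hlt
  have hcount : s.card ≤ (m.sort (· ≤ ·)).countP (· ≤ b) := by
    have h1 : (m.sort (· ≤ ·)).countP (· ≤ b) = m.countP (· ≤ b) := by
      conv_rhs => rw [← m.sort_eq (· ≤ ·)]
      rw [Multiset.coe_countP]
    rw [h1, hm, Multiset.countP_map]
    refine Finset.card_le_card (t := Finset.univ.filter fun i => x i ≤ b) fun i hi => ?_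
    simpa using hb i hi
  have hsplit := List.take_append_drop (j - 1) (m.sort (· ≤ ·))
  have hdrop : ((m.sort (· ≤ ·)).drop (j - 1)).countP (· ≤ b) = 0 := by
    rw [List.countP_eq_zero]
    intro a ha
    obtain ⟨i, hi, rfl⟩ := List.mem_iff_getElem.1 ha
    rw [List.getElem_drop]
    have hsorted : (m.sort (· ≤ ·)).Pairwise (· ≤ ·) := m.pairwise_sort (· ≤ ·)
    have hle := hsorted.rel_get_of_le (a := ⟨j - 1, hjn⟩)
      (b := ⟨j - 1 + i, by rw [List.length_drop] at hi; omega⟩) (by simp)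
    simp only [List.get_eq_getElem] at hle
    simpa using hlt.trans_le hle
  rw [← hsplit, List.countP_append, hdrop] at hcount
  have htake := (List.countP_le_length (p := fun a => decide (a ≤ b))
    (l := (m.sort (· ≤ ·)).take (j - 1)))
  rw [List.length_take] at htake
  omega

lemma lt_orderStat {n j : ℕ} (x : Fin n → ℝ) (b : ℝ) (hj : j < n) (hb : ∀ i, b < x i) :
    b < orderStat (Multiset.map x Finset.univ.val) j := by
  unfold orderStat
  rw [List.getD_eq_getElem _ _ (by simpa using hj)]
  have hmem := List.getElem_mem (l := (Multiset.map x Finset.univ.val).sort (· ≤ ·)) (n := j)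
    (by simpa using hj)
  rw [Multiset.mem_sort, Multiset.mem_map] at hmem
  obtain ⟨i, -, hi⟩ := hmem
  exact hi ▸ hb i

/-- At least `j` coordinates of `x` are at most `β j`, for every `1 ≤ j ≤ n`. -/
def CountBounded (β : ℕ → ℝ) {n : ℕ} (x : Fin n → ℝ) : Prop :=
  ∀ j, 1 ≤ j → j ≤ n → ∃ s : Finset (Fin n), j ≤ s.card ∧ ∀ i ∈ s, x i ≤ β j

lemma measurableSet_countBounded (β : ℕ → ℝ) (n : ℕ) :
    MeasurableSet {x : Fin n → ℝ | CountBounded β x} := by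
  unfold CountBounded
  simp only [ofPred_forall, ofPred_exists, ofPred_and]
  refine MeasurableSet.iInter fun j => MeasurableSet.iInter fun _ => MeasurableSet.iInter fun _ =>
    MeasurableSet.iUnion fun s => (MeasurableSet.const _).inter <|
    MeasurableSet.iInter fun i => MeasurableSet.iInter fun _ => ?_
  exact measurableSet_le (measurable_pi_apply i) measurable_const

lemma CountBounded.insertNth {β : ℕ → ℝ} {n : ℕ} {y : Fin n → ℝ} (hy : CountBounded β y)
    (hle : ∀ i, y i ≤ β (n + 1)) (I : Fin (n + 1)) {z : ℝ} (hz : z ≤ β (n + 1)) :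
    CountBounded β (I.insertNth z y : Fin (n + 1) → ℝ) := by
  intro j hj hjn
  rcases Nat.lt_or_ge n j with h | h
  · obtain rfl : j = n + 1 := by omega
    refine ⟨Finset.univ, by simp, fun i _ => ?_⟩
    rcases Fin.eq_self_or_eq_succAbove I i with rfl | ⟨m, rfl⟩
    · simpa using hz
    · simpa using hle m
  · obtain ⟨s, hs, hsb⟩ := hy j hj h
    refine ⟨s.map I.succAboveEmb, by simpa using hs, fun i hi => ?_⟩
    obtain ⟨m, hm, rfl⟩ := Finset.mem_map.1 hi
    simpa using hsb m hm

lemma measure_univ_of_map_eq {α : Type*} [MeasurableSpace α] {μ : Measure α} {f : α → ℝ}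
    (hf : Measurable f) {b : ℝ} (h : μ.map f = volume.restrict (Ioc 0 b)) :
    μ univ = ENNReal.ofReal b := by
  have := congrArg (fun ν => ν univ) h
  simpa [Measure.map_apply hf MeasurableSet.univ] using this

lemma measurable_insertNth {n : ℕ} (I : Fin (n + 1)) :
    Measurable fun p : ℝ × (Fin n → ℝ) => (I.insertNth p.1 p.2 : Fin (n + 1) → ℝ) := by
  refine measurable_pi_lambda _ fun i => ?_
  rcases Fin.eq_self_or_eq_succAbove I i with rfl | ⟨m, rfl⟩
  · simpa using measurable_fst
  · simpa [Function.comp_def] using (measurable_pi_apply m).comp measurable_snd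

/-- Each coordinate of the sum, over the insertion position, of `ν ⊗ μ` has the mixture law. -/
lemma map_eval_sum_insertNth {n : ℕ} (ν l : Measure ℝ) [IsFiniteMeasure ν]
    (μ : Measure (Fin n → ℝ)) [IsFiniteMeasure μ] (hμ : ∀ i, μ.map (fun x => x i) = l)
    (i : Fin (n + 1)) :
    (∑ I : Fin (n + 1), (ν.prod μ).map
        (fun p => (I.insertNth p.1 p.2 : Fin (n + 1) → ℝ))).map (fun x => x i)
      = μ univ • ν + n • (ν univ • l) := by
  rw [← Measure.mapₗ_apply_of_measurable (measurable_pi_apply i), map_sum,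
    Fin.sum_univ_succAbove _ i]
  simp only [Measure.mapₗ_apply_of_measurable (measurable_pi_apply i)]
  congr 1
  · rw [Measure.map_map (measurable_pi_apply i) (measurable_insertNth i)]
    simp only [Function.comp_def, Fin.insertNth_apply_same]
    exact Measure.map_fst_prod
  · rw [Finset.sum_congr rfl (g := fun _ => ν univ • l), Finset.sum_const, Finset.card_univ,
      Fintype.card_fin]
    intro j _
    rw [Measure.map_map (measurable_pi_apply i) (measurable_insertNth _)]
    obtain h | ⟨m, hm⟩ := Fin.eq_self_or_eq_succAbove (i.succAbove j) i
    · exact absurd h.symm (Fin.succAbove_ne i j)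
    · have : ((fun x : Fin (n + 1) → ℝ => x i) ∘ fun p : ℝ × (Fin n → ℝ) =>
          ((i.succAbove j).insertNth p.1 p.2 : Fin (n + 1) → ℝ))
          = (fun x => x m) ∘ Prod.snd := by
        funext p
        have happ := Fin.insertNth_apply_succAbove (α := fun _ => ℝ) (i.succAbove j) p.1 p.2 m
        rwa [← hm] at happ
      rw [this, ← Measure.map_map (measurable_pi_apply m) measurable_snd, Measure.map_snd_prod,
        Measure.map_smul, hμ]

lemma restrict_Ioc_add_restrict_Ioc {a b c : ℝ} (hab : a ≤ b) (hbc : b ≤ c) :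
    (volume.restrict (Ioc a b) + volume.restrict (Ioc b c) : Measure ℝ)
      = volume.restrict (Ioc a c) := by
  rw [← Ioc_union_Ioc_eq_Ioc hab hbc,
    Measure.restrict_union (Ioc_disjoint_Ioc_of_le le_rfl) measurableSet_Ioc]

/-- A mixing measure on `(0, c]` which extends Lebesgue measure on `(0, b]` to `(0, c]`. -/
lemma exists_mixing_measure (n : ℕ) {b c : ℝ} (hb : 0 < b) (hbc : b ≤ c)
    (h : n * (c - b) ≤ b) :
    ∃ ν : Measure ℝ, IsFiniteMeasure ν ∧ (∀ᵐ z ∂ν, z ≤ c) ∧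
      ENNReal.ofReal b • ν + n • (ν univ • (volume.restrict (Ioc 0 b) : Measure ℝ))
        = volume.restrict (Ioc 0 c) := by
  set a : ℝ := (1 - n * (c - b) / b) / ((n + 1) * b) with ha
  have ha0 : 0 ≤ a := by
    have : n * (c - b) / b ≤ 1 := (div_le_one hb).2 h
    have : 0 ≤ 1 - n * (c - b) / b := by linarith
    positivity
  have hcb : 0 ≤ c - b := by linarith
  refine ⟨ENNReal.ofReal a • volume.restrict (Ioc 0 b)
    + ENNReal.ofReal b⁻¹ • volume.restrict (Ioc b c), ⟨?_⟩, ?_, ?_⟩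
  · simp [ENNReal.mul_lt_top]
  · rw [ae_add_measure_iff]
    constructor
    · refine Measure.ae_smul_measure ?_ _
      filter_upwards [ae_restrict_mem measurableSet_Ioc] with z hz using hz.2.trans hbc
    · refine Measure.ae_smul_measure ?_ _
      filter_upwards [ae_restrict_mem measurableSet_Ioc] with z hz using hz.2
  · have hmass : (ENNReal.ofReal a • volume.restrict (Ioc 0 b)
        + ENNReal.ofReal b⁻¹ • volume.restrict (Ioc b c) : Measure ℝ) univ
        = ENNReal.ofReal (a * b + b⁻¹ * (c - b)) := by
      rw [ENNReal.ofReal_add (by positivity) (by positivity), ENNReal.ofReal_mul ha0,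
        ENNReal.ofReal_mul (by positivity)]
      simp
    have hone : ENNReal.ofReal b * ENNReal.ofReal b⁻¹ = 1 := by
      rw [← ENNReal.ofReal_mul hb.le, mul_inv_cancel₀ hb.ne', ENNReal.ofReal_one]
    have hcoef : ENNReal.ofReal b * ENNReal.ofReal a
        + n * ENNReal.ofReal (a * b + b⁻¹ * (c - b)) = 1 := by
      rw [← ENNReal.ofReal_mul hb.le, ← ENNReal.ofReal_natCast n,
        ← ENNReal.ofReal_mul (by positivity),
        ← ENNReal.ofReal_add (by positivity) (by positivity), ← ENNReal.ofReal_one]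
      congr 1
      rw [ha]
      field_simp
      ring
    rw [hmass, ← restrict_Ioc_add_restrict_Ioc hb.le hbc, smul_add, smul_smul, smul_smul, hone,
      one_smul, ← Nat.cast_smul_eq_nsmul ENNReal, smul_smul, add_right_comm, ← add_smul, hcoef,
      one_smul]

lemma exists_measure_countBounded (β : ℕ → ℝ) (k : ℕ) (hβpos : 0 < β 1)
    (hβmono : ∀ j, 1 ≤ j → j < k → β j ≤ β (j + 1))
    (hcond : ∀ j, 2 ≤ j → j ≤ k → (j : ℝ) * (β j - β (j - 1)) / β j ≤ 1)
    (n : ℕ) (hn : 1 ≤ n) (hnk : n ≤ k) :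
    0 < β n ∧ ∃ μ : Measure (Fin n → ℝ), IsFiniteMeasure μ ∧
      (∀ i, μ.map (fun x => x i) = volume.restrict (Ioc 0 (β n))) ∧
      ∀ᵐ x ∂μ, CountBounded β x := by
  induction n, hn using Nat.le_induction with
  | base =>
    refine ⟨hβpos, (volume.restrict (Ioc 0 (β 1))).map (fun t _ => t), inferInstance, fun i => ?_,
      ?_⟩
    · rw [Measure.map_map (measurable_pi_apply i) (by fun_prop)]
      exact Measure.map_id
    · rw [ae_map_iff (by fun_prop) (measurableSet_countBounded β 1)]
      filter_upwards [ae_restrict_mem measurableSet_Ioc] with t ht j hj hj1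
      obtain rfl : j = 1 := by omega
      exact ⟨Finset.univ, by simp, fun _ _ => ht.2⟩
  | succ n hn ih =>
    obtain ⟨hpos, μ, hμfin, hμ, hμb⟩ := ih (by omega)
    have hmono := hβmono n hn (by omega)
    have hpos' : 0 < β (n + 1) := hpos.trans_le hmono
    have hc := hcond (n + 1) (by omega) hnk
    rw [div_le_one hpos', Nat.add_sub_cancel] at hc
    push_cast at hc
    obtain ⟨ν, hνfin, hνle, hν⟩ := exists_mixing_measure n hpos hmono (by linarith)
    have huniv : μ univ = ENNReal.ofReal (β n) :=
      measure_univ_of_map_eq (measurable_pi_apply ⟨0, hn⟩) (hμ _)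
    refine ⟨hpos', ∑ I : Fin (n + 1), (ν.prod μ).map
      (fun p => (I.insertNth p.1 p.2 : Fin (n + 1) → ℝ)), inferInstance, fun i => ?_, ?_⟩
    · rw [map_eval_sum_insertNth ν _ μ hμ i, huniv, hν]
    · have hμle : ∀ᵐ y ∂μ, ∀ i, y i ≤ β (n + 1) := by
        rw [ae_all_iff]
        intro i
        have hi : ∀ᵐ t ∂(μ.map fun x => x i), t ≤ β (n + 1) := by
          rw [hμ i]
          filter_upwards [ae_restrict_mem measurableSet_Ioc] with t ht using ht.2.trans hmono
        exact ae_of_ae_map (measurable_pi_apply i).aemeasurable hi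
      rw [← Measure.sum_fintype, Measure.ae_sum_iff]
      intro I
      rw [ae_map_iff (measurable_insertNth I).aemeasurable (measurableSet_countBounded β _)]
      filter_upwards [Measure.quasiMeasurePreserving_fst.ae hνle,
        Measure.quasiMeasurePreserving_snd.ae hμle,
        Measure.quasiMeasurePreserving_snd.ae hμb] with p h1 h2 h3
      exact h3.insertNth h2 I h1

/-- Lemma 2.1 of Lehmann–Romano: given `0 < β_1 ≤ ⋯ ≤ β_k ≤ u` with
`j(β_j − β_{j−1})/β_j ≤ 1` for `j = 2, …, k`, there exist random variables
`q_1, …, q_k`, marginally uniform on `(0,u)`, whose order statistics satisfy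
`P{q_(1) ≤ β_1, …, q_(k) ≤ β_k} = β_k/u`. -/
theorem exists_joint_dist_orderStats
    (k : ℕ) (hk : 1 ≤ k) (u : ℝ) (hu : u ∈ Set.Ioc (0:ℝ) 1)
    (β : ℕ → ℝ) (hβpos : 0 < β 1)
    (hβmono : ∀ j, 1 ≤ j → j < k → β j ≤ β (j + 1)) (hβu : β k ≤ u)
    (hcond : ∀ j, 2 ≤ j → j ≤ k → (j : ℝ) * (β j - β (j - 1)) / β j ≤ 1) :
    ∃ (Ω : Type) (inst : MeasurableSpace Ω) (P : Measure Ω)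
      (instP : IsProbabilityMeasure P) (q : Fin k → Ω → ℝ),
      (∀ i, Measurable (q i)) ∧
      (∀ i, ∀ t ∈ Set.Icc (0:ℝ) u, P {ω | q i ω ≤ t} = ENNReal.ofReal (t / u)) ∧
      P {ω | ∀ j, 1 ≤ j → j ≤ k →
          orderStat (Multiset.map (fun i => q i ω) Finset.univ.val) (j - 1) ≤ β j}
        = ENNReal.ofReal (β k / u) := by
  obtain ⟨hpos, μ, hμfin, hμ, hμb⟩ :=
    exists_measure_countBounded β k hβpos hβmono hcond k hk le_rfl
  set δ : Measure (Fin k → ℝ) := (volume.restrict (Ioc (β k) u)).map (fun t _ => t) with hδ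
  have hmarg : ∀ i, (μ + δ).map (fun x => x i) = volume.restrict (Ioc 0 u) := by
    intro i
    rw [Measure.map_add _ _ (measurable_pi_apply i), hμ i, hδ,
      Measure.map_map (measurable_pi_apply i) (by fun_prop),
      ← restrict_Ioc_add_restrict_Ioc hpos.le hβu]
    congr 1
    exact Measure.map_id
  have hmeas : ∀ i : Fin k, Measurable fun x : Fin k → ℝ => x i := measurable_pi_apply
  have hscale : ∀ t : ℝ, (ENNReal.ofReal u)⁻¹ * ENNReal.ofReal t = ENNReal.ofReal (t / u) := by
    intro t
    rw [ENNReal.ofReal_div_of_pos hu.1, ENNReal.div_eq_inv_mul]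
  have hδlt : ∀ᵐ x ∂δ, ∀ i, β k < x i := by
    have hset : MeasurableSet {x : Fin k → ℝ | ∀ i, β k < x i} := by
      rw [ofPred_forall]
      exact MeasurableSet.iInter fun i => measurableSet_lt measurable_const (hmeas i)
    rw [hδ, ae_map_iff (by fun_prop) hset]
    filter_upwards [ae_restrict_mem measurableSet_Ioc] with t ht _ using ht.1
  refine ⟨Fin k → ℝ, inferInstance, (ENNReal.ofReal u)⁻¹ • (μ + δ), ⟨?_⟩, fun i x => x i, hmeas,
    fun i t ht => ?_, ?_⟩
  · rw [Measure.smul_apply, measure_univ_of_map_eq (hmeas ⟨0, hk⟩) (hmarg _), smul_eq_mul, hscale,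
      div_self hu.1.ne', ENNReal.ofReal_one]
  · have happ : (μ + δ) {x | x i ≤ t} = ENNReal.ofReal t := by
      have := congrArg (fun ρ => ρ (Iic t)) (hmarg i)
      simp only [Measure.map_apply (hmeas i) measurableSet_Iic,
        Measure.restrict_apply measurableSet_Iic, inter_comm (Iic t), Ioc_inter_Iic,
        Real.volume_Ioc, min_eq_right ht.2, sub_zero] at this
      exact this
    rw [Measure.smul_apply, happ, smul_eq_mul, hscale]
  · rw [Measure.smul_apply, Measure.add_apply, smul_eq_mul, ← hscale]
    congr 1
    rw [← measure_univ_of_map_eq (hmeas ⟨0, hk⟩) (hμ _), ← add_zero (μ univ)]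
    congr 1
    · refine measure_congr (Filter.eventuallyEq_univ.2 ?_)
      filter_upwards [hμb] with x hx j hj hjk
      obtain ⟨s, hs, hsb⟩ := hx j hj hjk
      exact orderStat_le_of_card x (β j) hj s hs hsb
    · rw [measure_eq_zero_iff_ae_notMem]
      filter_upwards [hδlt] with x hx hmem
      exact (lt_orderStat x (β k) (by omega : k - 1 < k) hx).not_ge (hmem k hk le_rfl)
end

section
/- Let α_j = kα/s for j ≤ k and α_j = kα/(s+k−j) for j > k. For every integer i with k ≤ i ≤ s, there exist a probability space and random variables p_1, …, p_s taking values in [0,1], of which s + k − i are marginally uniformly distributed on (0,1), such that the ordered values p_(1) ≤ ⋯ ≤ p_(s) satisfy P{p_(1) ≤ α_1, p_(2) ≤ α_2, …, p_(i) ≤ α_i} = α. -/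
open MeasureTheory Set

theorem List.getD_le_iff_lt_countP {L : List ℝ} (hL : L.Pairwise (· ≤ ·)) (c : ℝ) {i : ℕ}
    (hi : i < L.length) : L.getD i 0 ≤ c ↔ i < L.countP (fun x => decide (x ≤ c)) := by
  induction L generalizing i with
  | nil => simp at hi
  | cons a t ih =>
    rw [List.pairwise_cons] at hL
    by_cases hac : a ≤ c
    · rw [List.countP_cons_of_pos (by simpa using hac)]
      cases i with
      | zero => simpa using hac
      | succ i =>
        rw [List.getD_cons_succ, ih hL.2 (by simpa using hi)]
        omega
    · have hnot : ∀ x ∈ a :: t, ¬ x ≤ c := by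
        intro x hx hxc
        rcases List.mem_cons.1 hx with rfl | hx
        · exact hac hxc
        · exact hac ((hL.1 x hx).trans hxc)
      have h0 : (a :: t).countP (fun x => decide (x ≤ c)) = 0 := by
        rw [List.countP_eq_zero]
        simpa using hnot
      rw [h0, List.getD_eq_getElem _ _ hi]
      simpa using hnot _ (List.getElem_mem hi)

theorem orderStat_map_univ_le_iff {s : ℕ} (f : Fin s → ℝ) (c : ℝ) {i : ℕ} (hi : i < s) :
    orderStat (Multiset.map f Finset.univ.val) i ≤ c ↔
      i < (Finset.univ.filter fun t => f t ≤ c).card := by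
  unfold orderStat
  rw [List.getD_le_iff_lt_countP (Multiset.pairwise_sort _ _) c (by simpa using hi),
    ← Multiset.coe_countP, Multiset.sort_eq, Multiset.countP_map]
  rfl

/-- The rotation by `b` of the circle `[0, a)`, extended by the identity above `a`. -/
noncomputable def circleShift (a b u : ℝ) : ℝ :=
  if a < u then u else if u + b < a then u + b else u + b - a

theorem measurable_circleShift (a b : ℝ) : Measurable (circleShift a b) := by
  unfold circleShift
  refine Measurable.ite measurableSet_Ioi measurable_id (Measurable.ite ?_ ?_ ?_)
  · exact measurableSet_lt (by fun_prop) (by fun_prop)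
  · fun_prop
  · fun_prop

theorem circleShift_mem_Icc {a b u : ℝ} (ha : a ≤ 1) (hb : b ∈ Ico 0 a) (hu : u ∈ Icc (0 : ℝ) 1) :
    circleShift a b u ∈ Icc (0 : ℝ) 1 := by
  obtain ⟨hb0, hba⟩ := hb
  obtain ⟨hu0, hu1⟩ := hu
  unfold circleShift
  split_ifs <;> constructor <;> linarith

theorem volume_circleShift_le {a b t : ℝ} (ha : a ≤ 1) (hb : b ∈ Ico 0 a)
    (ht : t ∈ Ioo (0 : ℝ) 1) :
    volume ({u | circleShift a b u ≤ t} ∩ Icc 0 1) = ENNReal.ofReal t := by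
  obtain ⟨hb0, hba⟩ := hb
  obtain ⟨ht0, ht1⟩ := ht
  rcases le_or_gt a t with hat | hta
  · have : {u | circleShift a b u ≤ t} ∩ Icc 0 1 = Icc 0 t := by
      ext u
      simp only [circleShift, mem_inter_iff, mem_ofPred_eq, mem_Icc]
      split_ifs <;> constructor <;> intro h <;> (try obtain ⟨h1, h2, h3⟩ := h) <;>
        refine ⟨?_, ?_⟩ <;> (try constructor) <;> linarith
    rw [this, Real.volume_Icc, sub_zero]
  rcases lt_or_ge t b with htb | hbt
  · have : {u | circleShift a b u ≤ t} ∩ Icc 0 1 = Icc (a - b) (a - b + t) := by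
      ext u
      simp only [circleShift, mem_inter_iff, mem_ofPred_eq, mem_Icc]
      split_ifs <;> constructor <;> rintro ⟨h1, h2⟩ <;> (try obtain ⟨h2, h3⟩ := h2) <;>
        refine ⟨?_, ?_⟩ <;> (try constructor) <;> linarith
    rw [this, Real.volume_Icc, add_sub_cancel_left]
  · have : {u | circleShift a b u ≤ t} ∩ Icc 0 1 = Icc 0 (t - b) ∪ Icc (a - b) a := by
      ext u
      simp only [circleShift, mem_inter_iff, mem_ofPred_eq, mem_Icc, mem_union]
      constructor
      · rintro ⟨h1, h2, h3⟩
        split_ifs at h1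
        · linarith
        · left; constructor <;> linarith
        · right; constructor <;> linarith
      · rintro (⟨h1, h2⟩ | ⟨h1, h2⟩) <;> split_ifs <;> refine ⟨?_, ?_, ?_⟩ <;> linarith
    rw [this, measure_union _ measurableSet_Icc, Real.volume_Icc, Real.volume_Icc,
      ← ENNReal.ofReal_add (by linarith) (by linarith)]
    · congr 1; ring
    · rw [Set.disjoint_left]
      rintro u ⟨_, h1⟩ ⟨h2, _⟩
      linarith

/-- The shifts of a point of `[0, a]` by the multiples of `a / n` meet each cell
`[d * a / n, (d + 1) * a / n]`. -/
theorem exists_injOn_circleShift_le {n : ℕ} {a u : ℝ} (hn : 0 < n) (ha : 0 < a)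
    (hu : u ∈ Icc 0 a) :
    ∃ f : ℕ → ℕ, InjOn f (Iio n) ∧ ∀ d < n, f d < n ∧
      circleShift a ((f d : ℝ) * a / n) u ≤ ((d : ℝ) + 1) * a / n := by
  obtain ⟨hu0, hua⟩ := hu
  have hn' : (0 : ℝ) < n := by exact_mod_cast hn
  have hx0 : 0 ≤ u * n / a := by positivity
  obtain ⟨r, hr⟩ : ∃ r : ℕ, r = ⌊u * n / a⌋₊ := ⟨_, rfl⟩
  have h1 : (r : ℝ) ≤ u * n / a := hr ▸ Nat.floor_le hx0
  have h2 : u * n / a < r + 1 := hr ▸ Nat.lt_floor_add_one _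
  have hrn : r ≤ n := by
    have : (r : ℝ) ≤ n := h1.trans (by rw [div_le_iff₀ ha]; nlinarith)
    exact_mod_cast this
  rw [le_div_iff₀ ha] at h1
  rw [div_lt_iff₀ ha] at h2
  refine ⟨fun d => if r ≤ d then d - r else d + n - r, ?_, fun d hd => ⟨?_, ?_⟩⟩
  · intro d hd e he h
    simp only [mem_Iio] at hd he
    dsimp only at h
    split_ifs at h <;> omega
  · dsimp only
    split_ifs <;> omega
  · have hd' : (d : ℝ) + 1 ≤ n := by exact_mod_cast hd
    dsimp only
    rw [circleShift, if_neg (not_lt.2 hua)]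
    split_ifs with hrd h h
    · rw [Nat.cast_sub hrd, ← sub_nonneg]
      have : ((d : ℝ) + 1) * a / n - (u + ((d : ℝ) - r) * a / n) = ((r + 1) * a - u * n) / n := by
        field_simp; ring
      rw [this]
      exact div_nonneg (by linarith) hn'.le
    · rw [Nat.cast_sub hrd] at h ⊢
      exfalso
      apply h
      rw [← sub_pos]
      have : a - (u + ((d : ℝ) - r) * a / n) = ((n - d + r) * a - u * n) / n := by
        field_simp; ring
      rw [this]
      apply div_pos _ hn'
      nlinarith
    · rw [Nat.cast_sub (by omega), Nat.cast_add] at h ⊢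
      exfalso
      rw [← sub_pos] at h
      have : a - (u + ((d : ℝ) + n - r) * a / n) = ((r - d) * a - u * n) / n := by
        field_simp; ring
      rw [this, div_pos_iff_of_pos_right hn'] at h
      nlinarith [(Nat.cast_nonneg d : (0 : ℝ) ≤ d)]
    · rw [Nat.cast_sub (by omega), Nat.cast_add, ← sub_nonneg]
      have : ((d : ℝ) + 1) * a / n - (u + ((d : ℝ) + n - r) * a / n - a)
          = ((r + 1) * a - u * n) / n := by
        field_simp; ring
      rw [this]
      exact div_nonneg (by linarith) hn'.le

/-- Theorem 2.3(i) of Lehmann–Romano: for the constants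
`α_j = kα/s` (`j ≤ k`), `α_j = kα/(s+k−j)` (`j > k`), and any `k ≤ i ≤ s`,
there is a joint distribution of `p_1, …, p_s`, of which `s + k − i` are
marginally uniform on `(0,1)`, such that
`P{p_(1) ≤ α_1, …, p_(i) ≤ α_i} = α`. -/
theorem stepdown_constants_sharp
    (s k : ℕ) (hk1 : 1 ≤ k) (hks : k ≤ s) (α : ℝ) (hα : α ∈ Set.Ioo (0:ℝ) 1)
    (i : ℕ) (hki : k ≤ i) (his : i ≤ s)
    (c : ℕ → ℝ)
    (hc : ∀ j, 1 ≤ j → j ≤ s →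
      c j = if j ≤ k then (k : ℝ) * α / (s : ℝ)
            else (k : ℝ) * α / ((s : ℝ) + (k : ℝ) - (j : ℝ))) :
    ∃ (Ω : Type) (inst : MeasurableSpace Ω) (P : Measure Ω)
      (instP : IsProbabilityMeasure P) (p : Fin s → Ω → ℝ) (T : Finset (Fin s)),
      (∀ j, Measurable (p j)) ∧
      (∀ j ω, p j ω ∈ Set.Icc (0:ℝ) 1) ∧
      T.card = s + k - i ∧
      (∀ j ∈ T, ∀ u ∈ Set.Ioo (0:ℝ) 1, P {ω | p j ω ≤ u} = ENNReal.ofReal u) ∧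
      P {ω | ∀ j, 1 ≤ j → j ≤ i →
          orderStat (Multiset.map (fun t => p t ω) Finset.univ.val) (j - 1) ≤ c j}
        = ENNReal.ofReal α := by
  obtain ⟨hα0, hα1⟩ := hα
  obtain ⟨n, hn⟩ : ∃ n, n = s + k - i := ⟨_, rfl⟩
  have hn0 : 0 < n := by omega
  have hn' : (0 : ℝ) < n := by exact_mod_cast hn0
  have hnR : (n : ℝ) = s + k - i := by rw [hn, Nat.cast_sub (by omega), Nat.cast_add]
  have hk' : (0 : ℝ) < k := by exact_mod_cast hk1
  have hs' : (0 : ℝ) < s := by exact_mod_cast (by omega : 0 < s)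
  have hksR : (k : ℝ) ≤ s := by exact_mod_cast hks
  have hkiR : (k : ℝ) ≤ i := by exact_mod_cast hki
  have hisR : (i : ℝ) ≤ s := by exact_mod_cast his
  have hshift : ∀ j : ℕ, j < n → (j : ℝ) * α / n ∈ Ico 0 α := by
    intro j hj
    have hj' : (j : ℝ) < n := by exact_mod_cast hj
    refine ⟨by positivity, ?_⟩
    rw [div_lt_iff₀ hn']
    nlinarith
  let p : Fin s → unitInterval → ℝ := fun j ω =>
    if (j : ℕ) < n then circleShift α ((j : ℕ) * α / n) ω else 0
  let T : Finset (Fin s) := Finset.univ.filter fun j => (j : ℕ) < n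
  have hT : T.card = n := by
    simp only [T, Fin.card_filter_val_lt]
    omega
  have hmeas : ∀ j, Measurable (p j) := by
    intro j
    by_cases hj : (j : ℕ) < n
    · simp only [p, if_pos hj]
      exact (measurable_circleShift _ _).comp measurable_subtype_coe
    · simp only [p, if_neg hj]
      exact measurable_const
  have hvol : ∀ S : Set ℝ, MeasurableSet S →
      (volume : Measure unitInterval) {ω | (ω : ℝ) ∈ S} = volume (S ∩ Icc 0 1) := by
    intro S hS
    rw [← Measure.restrict_apply hS]
    exact (measurePreserving_subtype_coe measurableSet_Icc).measure_preimage hS.nullMeasurableSet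
  have hc0 : ∀ j, 1 ≤ j → j ≤ i → 0 ≤ c j := by
    intro j hj1 hji
    have : (j : ℝ) ≤ i := by exact_mod_cast hji
    rw [hc j hj1 (by omega)]
    split_ifs
    · positivity
    · exact div_nonneg (by positivity) (by linarith)
  have hcm : ∀ j, 1 ≤ j → j ≤ i → ∀ m : ℕ, j + k = m + i → (m : ℝ) * α / n ≤ c j := by
    intro j hj1 hji m hm
    have hjR : (j : ℝ) ≤ i := by exact_mod_cast hji
    have hmR : (m : ℝ) = j + k - i := by
      have : (j : ℝ) + k = m + i := by exact_mod_cast hm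
      linarith
    rw [hc j hj1 (by omega)]
    split_ifs with hjk
    · have hjkR : (j : ℝ) ≤ k := by exact_mod_cast hjk
      rw [div_le_div_iff₀ hn' hs']
      have : (m : ℝ) * s ≤ k * n := by
        rw [hmR, hnR]
        nlinarith [mul_nonneg (sub_nonneg.2 hjkR) hs'.le,
          mul_nonneg (sub_nonneg.2 hkiR) (sub_nonneg.2 hksR)]
      nlinarith
    · rw [div_le_div_iff₀ hn' (by linarith)]
      have : (m : ℝ) * (s + k - j) ≤ k * n := by
        rw [hmR, hnR]
        nlinarith [mul_nonneg (sub_nonneg.2 (hjR.trans hisR)) (sub_nonneg.2 hjR)]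
      nlinarith
  have hci : c i ≤ α := by
    have hkn : (k : ℝ) ≤ n := by rw [hnR]; linarith
    have : c i = k * α / n := by
      rw [hc i (by omega) his]
      split_ifs with hik
      · have : i = k := by omega
        subst this
        rw [hnR]; congr 1; ring
      · rw [hnR]
    rw [this, div_le_iff₀ hn']
    nlinarith
  refine ⟨unitInterval, inferInstance, volume, inferInstance, p, T, hmeas, ?_, hT.trans hn, ?_, ?_⟩
  · intro j ω
    by_cases hj : (j : ℕ) < n
    · simp only [p, if_pos hj]
      exact circleShift_mem_Icc hα1.le (hshift _ hj) ω.2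
    · simp [p, if_neg hj]
  · intro j hj t ht
    have hj' : (j : ℕ) < n := by simpa [T] using hj
    simp only [p, if_pos hj']
    rw [← volume_circleShift_le hα1.le (hshift _ hj') ht]
    exact hvol {u | circleShift α ((j : ℕ) * α / n) u ≤ t}
      (measurableSet_le (measurable_circleShift _ _) measurable_const)
  · have hE : {ω : unitInterval | ∀ j, 1 ≤ j → j ≤ i →
        orderStat (Multiset.map (fun t => p t ω) Finset.univ.val) (j - 1) ≤ c j}
        = {ω : unitInterval | (ω : ℝ) ∈ Iic α} := by
      ext ω
      simp only [mem_ofPred_eq, mem_Iic]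
      constructor
      · intro h
        by_contra! hω
        have h' := h i (by omega) le_rfl
        rw [orderStat_map_univ_le_iff _ _ (by omega)] at h'
        have hsub : (Finset.univ.filter fun t => p t ω ≤ c i) ⊆ Tᶜ := by
          intro t ht
          simp only [Finset.mem_filter, Finset.mem_univ, true_and] at ht
          simp only [T, Finset.mem_compl, Finset.mem_filter, Finset.mem_univ, true_and]
          intro htn
          simp only [p, if_pos htn, circleShift, if_pos hω] at ht
          linarith
        have := Finset.card_le_card hsub
        rw [Finset.card_compl, Fintype.card_fin, hT] at this
        omega
      · intro hω j hj1 hji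
        rw [orderStat_map_univ_le_iff _ _ (by omega)]
        obtain ⟨f, hf, hfn⟩ := exists_injOn_circleShift_le hn0 hα0 ⟨ω.2.1, hω⟩
        obtain ⟨m, hm⟩ : ∃ m, m = j - (i - k) := ⟨_, rfl⟩
        let g : Fin j → Fin s := fun d =>
          if h : (d : ℕ) < m then ⟨f d, by have := (hfn d (by omega)).1; omega⟩
          else ⟨n + (d - m), by omega⟩
        have hg : Function.Injective g := by
          intro d e hde
          have hv : (g d : ℕ) = g e := congrArg _ hde
          simp only [g] at hv
          ext
          split_ifs at hv with h1 h2 h2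
          · exact hf (mem_Iio.2 (by omega)) (mem_Iio.2 (by omega)) hv
          · have := (hfn d (by omega)).1
            simp only at hv
            omega
          · have := (hfn e (by omega)).1
            simp only at hv
            omega
          · simp only at hv
            omega
        have hle : ∀ d, p (g d) ω ≤ c j := by
          intro d
          by_cases hd : (d : ℕ) < m
          · have hfd := hfn d (by omega)
            simp only [p, g, dif_pos hd, if_pos hfd.1]
            refine hfd.2.trans (le_trans ?_ (hcm j hj1 hji m (by omega)))
            have : (d : ℝ) + 1 ≤ m := by exact_mod_cast hd
            gcongr
          · simp only [p, g, dif_neg hd]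
            rw [if_neg (by omega)]
            exact hc0 j hj1 hji
        have hcard : (Finset.univ.image g).card ≤
            (Finset.univ.filter fun t => p t ω ≤ c j).card := by
          apply Finset.card_le_card
          intro t ht
          obtain ⟨d, -, rfl⟩ := Finset.mem_image.1 ht
          simpa using hle d
        rw [Finset.card_image_of_injective _ hg, Finset.card_univ, Fintype.card_fin] at hcard
        omega
    rw [hE, hvol _ measurableSet_Iic]
    have : Iic α ∩ Icc 0 1 = Icc 0 α := by
      ext u
      simp only [mem_inter_iff, mem_Iic, mem_Icc]
      constructor
      · rintro ⟨h1, h2, -⟩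
        exact ⟨h2, h1⟩
      · rintro ⟨h1, h2⟩
        exact ⟨h2, h1, h2.trans hα1.le⟩
    rw [this, Real.volume_Icc, sub_zero]
end

section
/- Let α_j = kα/s for j ≤ k and α_j = kα/(s+k−j) for j > k. Fix i with k ≤ i ≤ s and any β with α_i < β ≤ (s/k)·α_i, and consider the stepdown procedure using constants α_1, …, α_{i−1}, β, α_{i+1}, …, α_s (with the later constants adjusted so the sequence is nondecreasing). Then there exist a probability space, random variables p_1, …, p_s taking values in [0,1], and a set I ⊆ {1,…,s} of true null hypotheses with |I| = s + k − i and P{p_j ≤ u} ≤ u for all j ∈ I and u ∈ (0,1), such that the probability that this stepdown procedure rejects at least k hypotheses indexed by I is strictly greater than α. Hence no α_i with i ≥ k can be increased without violating k-FWER control. -/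
open MeasureTheory Set

/-- If more than `idx` values are at most `x`, then so is the value at sorted position `idx`. -/
lemma sorted_apply_le_of_lt_card {s : ℕ} {q : Fin s → ℝ} {τ : Equiv.Perm (Fin s)}
    (hτ : Monotone fun idx => q (τ idx)) {x : ℝ} {idx : Fin s}
    (h : idx.val < (Finset.univ.filter fun j => q j ≤ x).card) : q (τ idx) ≤ x := by
  by_contra! hx
  have hsub : (Finset.univ.filter fun j => q j ≤ x) ⊆ (Finset.Iio idx).image τ := by
    intro j hj
    rw [Finset.mem_filter] at hj
    refine Finset.mem_image.2 ⟨τ.symm j, ?_, τ.apply_symm_apply j⟩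
    rw [Finset.mem_Iio]
    by_contra! hle
    have := hτ hle
    simp only [Equiv.apply_symm_apply] at this
    linarith [hj.2]
  have := (Finset.card_le_card hsub).trans Finset.card_image_le
  rw [Fin.card_Iio] at this
  omega

/-- If the first `i` sorted p-values lie below the critical constants and at most `i - k`
hypotheses are false, then the stepdown procedure rejects at least `k` true hypotheses. -/
lemma le_card_true_rejections {s k i : ℕ} (hki : k ≤ i) (his : i ≤ s) {q : Fin s → ℝ}
    {τ : Equiv.Perm (Fin s)} {d : ℕ → ℝ} {I : Finset (Fin s)} (hI : I.card = s + k - i)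
    (h : ∀ idx : Fin s, idx.val < i → q (τ idx) ≤ d (idx.val + 1)) :
    k ≤ (Finset.univ.filter fun idx : Fin s =>
      idx.val < (Finset.univ.filter fun r : Fin s =>
        ∀ i' : Fin s, i' ≤ r → q (τ i') ≤ d (i'.val + 1)).card ∧ τ idx ∈ I).card := by
  have hcard : (Finset.univ.filter fun r : Fin s => r.val < i).card = i := by
    rw [Fin.card_filter_val_lt, min_eq_right his]
  have hR : i ≤ (Finset.univ.filter fun r : Fin s =>
      ∀ i' : Fin s, i' ≤ r → q (τ i') ≤ d (i'.val + 1)).card := by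
    rw [← hcard]
    refine Finset.card_le_card fun r hr => ?_
    simp only [Finset.mem_filter, Finset.mem_univ, true_and] at hr ⊢
    exact fun i' hi' => h i' (lt_of_le_of_lt hi' hr)
  have hcover : (Finset.univ.filter fun r : Fin s => r.val < i) ⊆
      (Finset.univ.filter fun idx : Fin s =>
        idx.val < (Finset.univ.filter fun r : Fin s =>
          ∀ i' : Fin s, i' ≤ r → q (τ i') ≤ d (i'.val + 1)).card ∧ τ idx ∈ I) ∪
      Iᶜ.image τ.symm := by
    intro r hr
    simp only [Finset.mem_filter, Finset.mem_univ, true_and] at hr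
    by_cases hrI : τ r ∈ I
    · exact Finset.mem_union_left _
        (Finset.mem_filter.2 ⟨Finset.mem_univ _, lt_of_lt_of_le hr hR, hrI⟩)
    · exact Finset.mem_union_right _
        (Finset.mem_image.2 ⟨τ r, Finset.mem_compl.2 hrI, τ.symm_apply_apply r⟩)
  have h1 := (Finset.card_le_card hcover).trans (Finset.card_union_le _ _)
  have h2 : (Iᶜ.image τ.symm).card ≤ s - I.card :=
    Finset.card_image_le.trans (by rw [Finset.card_compl, Fintype.card_fin])
  rw [hcard] at h1
  omega

/-- The rank of hypothesis `j < s` when the `s - n` hypotheses `j ≥ n` come first and the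
hypotheses `j < n` follow in cyclic order, rotated by `r`. -/
def rotatedRank (s n r j : ℕ) : ℕ := if j < n then s - n + (j + r) % n else j - n

lemma rotatedRank_lt {s n j : ℕ} (hns : n ≤ s) (r : ℕ) (hj : j < s) :
    rotatedRank s n r j < s := by
  unfold rotatedRank
  split_ifs with h
  · have := Nat.mod_lt (j + r) (Nat.zero_lt_of_lt h)
    omega
  · omega

lemma eq_of_add_mod_eq {n a b r : ℕ} (ha : a < n) (hb : b < n)
    (h : (a + r) % n = (b + r) % n) : a = b := by
  have := Nat.ModEq.add_right_cancel' (n := n) r h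
  rwa [Nat.ModEq, Nat.mod_eq_of_lt ha, Nat.mod_eq_of_lt hb] at this

lemma rotatedRank_inj {s n r a b : ℕ} (ha : a < s) (hb : b < s)
    (h : rotatedRank s n r a = rotatedRank s n r b) : a = b := by
  unfold rotatedRank at h
  split_ifs at h with h1 h2 h2
  · exact eq_of_add_mod_eq h1 h2 (Nat.add_left_cancel h)
  all_goals omega

lemma card_rotatedRank_lt {s n m : ℕ} (hns : n ≤ s) (r : ℕ) (hm : m ≤ s) :
    (Finset.univ.filter fun j : Fin s => rotatedRank s n r j < m).card = m := by
  have hinj : Function.Injective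
      fun j : Fin s => (⟨rotatedRank s n r j, rotatedRank_lt hns r j.2⟩ : Fin s) :=
    fun a b hab => Fin.ext (rotatedRank_inj a.2 b.2 (congrArg Fin.val hab))
  have hbij := Finite.injective_iff_bijective.1 hinj
  rw [← Finset.card_map (Equiv.ofBijective _ hbij).toEmbedding]
  have : (Finset.univ.filter fun j : Fin s => rotatedRank s n r j < m).map
      (Equiv.ofBijective _ hbij).toEmbedding = Finset.univ.filter fun j : Fin s => j.val < m := by
    ext x
    obtain ⟨y, rfl⟩ := hbij.2 x
    simp only [Finset.mem_map, Finset.mem_filter, Finset.mem_univ, true_and]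
    constructor
    · rintro ⟨z, hz, hzy⟩
      have hzy : z = y := hbij.1 hzy
      rwa [← hzy]
    · exact fun hy => ⟨y, hy, rfl⟩
  rw [this, Fin.card_filter_val_lt, min_eq_right hm]

/-- The strict room left between the stepdown constants and the multiples of `α / n`. -/
lemma sub_mul_div_lt_stepdown {s k i : ℕ} (hk1 : 1 ≤ k) (hks : k ≤ s) {α : ℝ} (hα : 0 < α)
    (hki : k ≤ i) (his : i ≤ s) {m : ℕ} (hmi : m < i) :
    ((m - (i - k) : ℕ) : ℝ) * (α / (s + k - i : ℕ)) <
      if m ≤ k then (k : ℝ) * α / (s : ℝ) else (k : ℝ) * α / ((s : ℝ) + (k : ℝ) - (m : ℝ)) := by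
  have hk : (0 : ℝ) < k := by exact_mod_cast hk1
  have hs : (0 : ℝ) < s := by exact_mod_cast hk1.trans hks
  have hms : (m : ℝ) < s := by exact_mod_cast hmi.trans_le his
  have hle : (k : ℝ) * α / ((s : ℝ) + k - m) ≤
      if m ≤ k then (k : ℝ) * α / (s : ℝ) else (k : ℝ) * α / ((s : ℝ) + (k : ℝ) - (m : ℝ)) := by
    split_ifs with h
    · have : (m : ℝ) ≤ k := by exact_mod_cast h
      gcongr
      linarith
    · exact le_rfl
  refine lt_of_lt_of_le ?_ hle
  have hden : (0 : ℝ) < (s : ℝ) + k - m := by linarith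
  rcases Nat.le_total m (i - k) with h | h
  · rw [Nat.sub_eq_zero_of_le h]
    simp only [Nat.cast_zero, zero_mul]
    positivity
  · have hn : ((s + k - i : ℕ) : ℝ) = s + k - i := by
      rw [Nat.cast_sub (by omega)]; push_cast; ring
    have hj : ((m - (i - k) : ℕ) : ℝ) = m - (i - k) := by
      rw [Nat.cast_sub h, Nat.cast_sub hki]
    have hmi' : (m : ℝ) < i := by exact_mod_cast hmi
    have his' : (i : ℝ) ≤ s := by exact_mod_cast his
    have hnpos : (0 : ℝ) < (s : ℝ) + k - i := by linarith
    rw [hn, hj, ← mul_div_assoc, div_lt_div_iff₀ hnpos hden]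
    nlinarith [mul_pos hα (mul_pos (sub_pos.2 hmi') (sub_pos.2 hms))]

/-- With probability `1 - l` the outcome is `none`, otherwise a uniform rotation. -/
noncomputable def rotationMeasure (n : ℕ) (l : ℝ) : @Measure (Option (Fin n)) ⊤ :=
  letI : MeasurableSpace (Option (Fin n)) := ⊤
  ENNReal.ofReal (1 - l) • Measure.dirac none +
    ∑ r : Fin n, ENNReal.ofReal (l / n) • Measure.dirac (some r)

lemma rotationMeasure_apply {n : ℕ} {l : ℝ} (S : Set (Option (Fin n)))
    [DecidablePred (· ∈ S)] :
    rotationMeasure n l S = (if none ∈ S then ENNReal.ofReal (1 - l) else 0) +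
      ENNReal.ofReal ((Finset.univ.filter fun r : Fin n => some r ∈ S).card * (l / n)) := by
  let _ : MeasurableSpace (Option (Fin n)) := ⊤
  have hS : MeasurableSet S := trivial
  rw [ENNReal.ofReal_mul (Nat.cast_nonneg _), ENNReal.ofReal_natCast]
  simp [rotationMeasure, Measure.dirac_apply' _ hS, Set.indicator_apply, Finset.sum_ite]

lemma card_mul_le_of_add_mod {n j : ℕ} {c u : ℝ} (hc : 0 < c) (hu : 0 ≤ u) :
    ((Finset.univ.filter fun r : Fin n => (((j + r) % n + 1 : ℕ) : ℝ) * c ≤ u).card : ℝ) * c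
      ≤ u := by
  rw [← le_div_iff₀ hc]
  refine le_trans ?_ (Nat.floor_le (div_nonneg hu hc.le))
  rw [← Finset.card_range ⌊u / c⌋₊, Nat.cast_le]
  refine Finset.card_le_card_of_injOn (fun r : Fin n => (j + r) % n) ?_ ?_
  · intro r hr
    simp only [Finset.coe_filter, Finset.mem_univ, true_and, Set.mem_ofPred_eq] at hr
    rw [Finset.mem_coe, Finset.mem_range, ← Nat.succ_le_iff]
    exact Nat.le_floor ((le_div_iff₀ hc).2 hr)
  · intro a _ b _ hab
    simp only [add_comm j] at hab
    exact Fin.ext (eq_of_add_mod_eq a.2 b.2 hab)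

/-- Theorem 2.3(ii) of Lehmann–Romano: none of the stepdown constants
`α_j = kα/s` (`j ≤ k`), `α_j = kα/(s+k−j)` (`j > k`) with index `j = i ≥ k` can be
increased (to some `β` with `α_i < β ≤ (s/k)·α_i`, adjusting later constants so the
sequence stays nondecreasing) without violating `k`-FWER control: there is a joint
distribution of the p-values, with `s + k − i` true null hypotheses `I` whose
p-values are stochastically dominated by the uniform, for which the modified
stepdown procedure makes at least `k` false rejections with probability `> α`. -/
theorem stepdown_constants_cannot_increase
    (s k : ℕ) (hk1 : 1 ≤ k) (hks : k ≤ s) (α : ℝ) (hα : α ∈ Set.Ioo (0:ℝ) 1)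
    (i : ℕ) (hki : k ≤ i) (his : i ≤ s)
    (a : ℕ → ℝ)
    (ha : ∀ j, 1 ≤ j → j ≤ s →
      a j = if j ≤ k then (k : ℝ) * α / (s : ℝ)
            else (k : ℝ) * α / ((s : ℝ) + (k : ℝ) - (j : ℝ)))
    (β : ℝ) (hβ1 : a i < β) (hβ2 : β ≤ ((s : ℝ) / (k : ℝ)) * a i)
    (d : ℕ → ℝ)
    (hd1 : ∀ j, 1 ≤ j → j < i → d j = a j)
    (hd2 : d i = β)
    (hd3 : ∀ j, i < j → j ≤ s → d j = max β (a j)) :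
    ∃ (Ω : Type) (inst : MeasurableSpace Ω) (P : Measure Ω)
      (instP : IsProbabilityMeasure P) (p : Fin s → Ω → ℝ) (I : Finset (Fin s)),
      (∀ j, Measurable (p j)) ∧
      (∀ j ω, p j ω ∈ Set.Icc (0:ℝ) 1) ∧
      I.card = s + k - i ∧
      (∀ j ∈ I, ∀ u ∈ Set.Ioo (0:ℝ) 1, P {ω | p j ω ≤ u} ≤ ENNReal.ofReal u) ∧
      ∀ (σ : Ω → Equiv.Perm (Fin s)),
        (∀ ω, Monotone fun idx => p (σ ω idx) ω) →
        (∀ idx : Fin s, Measurable fun ω => σ ω idx) →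
        ENNReal.ofReal α <
          P {ω | k ≤ (Finset.univ.filter (fun idx : Fin s =>
              idx.val < (Finset.univ.filter (fun r : Fin s =>
                  ∀ i' : Fin s, i' ≤ r → p (σ ω i') ω ≤ d (i'.val + 1))).card ∧
              σ ω idx ∈ I)).card} := by
  classical
  obtain ⟨hα0, hα1⟩ := hα
  set n := s + k - i with hn
  have hn0 : 0 < n := by omega
  have hns : n ≤ s := by omega
  have hsn : s - n = i - k := by omega
  have hnR : (0 : ℝ) < n := by exact_mod_cast hn0
  have hroom : ∀ m ∈ Finset.Icc 1 i, ((m - (i - k) : ℕ) : ℝ) * (α / n) < d m := by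
    intro m hm
    obtain ⟨hm1, hmi⟩ := Finset.mem_Icc.1 hm
    rcases hmi.lt_or_eq with hlt | rfl
    · rw [hd1 m hm1 hlt, ha m hm1 (by omega)]
      exact sub_mul_div_lt_stepdown hk1 hks hα0 hki his hlt
    · rw [hd2]
      refine lt_of_eq_of_lt ?_ hβ1
      rw [ha m hm1 his, Nat.sub_sub_self hki, mul_div_assoc]
      split_ifs with h
      · obtain rfl : m = k := le_antisymm h hki
        rw [show n = s by omega]
      · rw [hn, Nat.cast_sub (by omega), mul_div_assoc]
        push_cast
        ring
  obtain ⟨l, ⟨hld, hl1⟩, hαl⟩ : ∃ l : ℝ,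
      ((∀ m ∈ Finset.Icc 1 i, ((m - (i - k) : ℕ) : ℝ) * (l / n) < d m) ∧ l < 1) ∧ α < l := by
    have hev : ∀ᶠ l in nhds α,
        (∀ m ∈ Finset.Icc 1 i, ((m - (i - k) : ℕ) : ℝ) * (l / n) < d m) ∧ l < 1 := by
      refine Filter.Eventually.and ((Filter.eventually_all_finset _).2 fun m hm => ?_)
        (eventually_lt_nhds hα1)
      have hcont : Continuous fun l : ℝ => ((m - (i - k) : ℕ) : ℝ) * (l / n) := by fun_prop
      exact hcont.continuousAt.eventually_lt continuousAt_const (hroom m hm)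
    exact ((hev.filter_mono nhdsWithin_le_nhds).and
      (self_mem_nhdsWithin : Set.Ioi α ∈ nhdsWithin α (Set.Ioi α))).exists
  have hl0 : 0 < l := hα0.trans hαl
  have hln : 0 < l / n := div_pos hl0 hnR
  have hlsum : (n : ℝ) * (l / n) = l := by field_simp
  refine ⟨Option (Fin n), ⊤, rotationMeasure n l, ⟨?_⟩,
    fun j ω => ω.elim 1 fun r => ((rotatedRank s n r j + 1 - (s - n) : ℕ) : ℝ) * (l / n),
    Finset.univ.filter fun j : Fin s => j.val < n, fun j => measurable_from_top, ?_, ?_, ?_, ?_⟩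
  · rw [rotationMeasure_apply]
    simp only [Set.mem_univ, if_true, Finset.filter_true, Finset.card_univ, Fintype.card_fin,
      hlsum]
    rw [← ENNReal.ofReal_add (by linarith) hl0.le]
    simp
  · rintro j (_ | r)
    · simp
    · refine ⟨mul_nonneg (Nat.cast_nonneg _) hln.le, ?_⟩
      have hle : rotatedRank s n r j + 1 - (s - n) ≤ n := by
        have := rotatedRank_lt hns r j.2
        omega
      calc ((rotatedRank s n r j + 1 - (s - n) : ℕ) : ℝ) * (l / n) ≤ n * (l / n) := by gcongr
        _ ≤ 1 := by rw [hlsum]; exact hl1.le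
  · rw [Fin.card_filter_val_lt, min_eq_right hns]
  · intro j hj u hu
    have hjn : j.val < n := (Finset.mem_filter.1 hj).2
    rw [rotationMeasure_apply]
    have hrank (r : ℕ) : rotatedRank s n r j + 1 - (s - n) = (j + r) % n + 1 := by
      rw [rotatedRank, if_pos hjn]
      omega
    simp only [Set.mem_ofPred_eq, Option.elim_none, Option.elim_some, not_le.2 hu.2, if_false,
      zero_add, hrank]
    exact ENNReal.ofReal_le_ofReal (card_mul_le_of_add_mod hln hu.1.le)
  · intro σ hσ _
    have hrange : rotationMeasure n l (Set.range some) = ENNReal.ofReal l := by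
      rw [rotationMeasure_apply]
      simp [hlsum]
    refine ((ENNReal.ofReal_lt_ofReal_iff hl0).2 hαl).trans_le
      (hrange.symm.le.trans (measure_mono ?_))
    rintro _ ⟨r, rfl⟩
    rw [Set.mem_ofPred_eq]
    refine le_card_true_rejections (τ := σ (some r)) (d := d) hki his
      (q := fun j => ((rotatedRank s n r j + 1 - (s - n) : ℕ) : ℝ) * (l / n))
      (I := Finset.univ.filter fun j : Fin s => j.val < n)
      (by rw [Fin.card_filter_val_lt, min_eq_right hns]) fun idx hidx => ?_
    refine (sorted_apply_le_of_lt_card (x := ((idx.val + 1 - (i - k) : ℕ) : ℝ) * (l / n))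
      (q := fun j => ((rotatedRank s n r j + 1 - (s - n) : ℕ) : ℝ) * (l / n))
      (hσ (some r)) ?_).trans (hld _ (Finset.mem_Icc.2 ⟨Nat.succ_pos _, hidx⟩)).le
    rw [← Nat.succ_le_iff, ← card_rotatedRank_lt hns r (Nat.succ_le_of_lt idx.2)]
    refine Finset.card_le_card fun j hj => ?_
    simp only [Finset.mem_filter, Finset.mem_univ, true_and] at hj ⊢
    exact mul_le_mul_of_nonneg_right (Nat.cast_le.2 (by omega)) hln.le
end

section
/- Assume that for every i ∈ I, every u ∈ (0,1), and every event A in the σ-algebra generated by (p_j)_{j ∉ I}, one has P({p_i ≤ u} ∩ A) ≤ u · P(A). Then the stepdown procedure with constants α_i = (⌊γi⌋ + 1)α / (s + ⌊γi⌋ + 1 − i) satisfies P{FDP > γ} ≤ α. -/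
open MeasureTheory Set

/-- A lower set of `Fin s` is the initial segment determined by its cardinality. -/
lemma mem_iff_val_lt_card_of_isLowerSet {s : ℕ} (T : Finset (Fin s))
    (hT : IsLowerSet (T : Set (Fin s))) (r : Fin s) : r ∈ T ↔ r.val < T.card := by
  constructor
  · intro hr
    have h : Finset.Iic r ⊆ T := fun i hi => hT (Finset.mem_Iic.1 hi) hr
    have := Finset.card_le_card h
    rw [Fin.card_Iic] at this
    omega
  · intro hr
    by_contra hrT
    have h : T ⊆ Finset.Iio r := fun i hi =>
      Finset.mem_Iio.2 (lt_of_not_ge fun hri => hrT (hT hri hi))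
    have := Finset.card_le_card h
    rw [Fin.card_Iio] at this
    omega

lemma Fin.card_filter_val_lt_of_le {s j : ℕ} (hj : j ≤ s) :
    (Finset.univ.filter fun i : Fin s => i.val < j).card = j := by
  rw [Fin.card_filter_val_lt]
  exact min_eq_right hj

/-- Counting the values `≤ u` on `I` and off `I` amounts to counting them all. -/
lemma card_filter_add_card_filter_sdiff {s : ℕ} (v : Fin s → ℝ) (τ : Equiv.Perm (Fin s))
    (I : Finset (Fin s)) (u : ℝ) :
    (I.filter fun i => v i ≤ u).card + ((Finset.univ \ I).filter fun i => v i ≤ u).card =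
      (Finset.univ.filter fun i => v (τ i) ≤ u).card := by
  have h1 : (Finset.univ.filter fun i => v (τ i) ≤ u).card =
      (Finset.univ.filter fun i => v i ≤ u).card :=
    Finset.card_bij (fun i _ => τ i) (by simp) (by simp)
      (fun b hb => ⟨τ.symm b, by simpa using hb, by simp⟩)
  rw [h1, ← Finset.card_union_of_disjoint, ← Finset.filter_union]
  · rw [Finset.union_sdiff_of_subset (Finset.subset_univ I)]
  · exact Finset.disjoint_filter_filter Finset.disjoint_sdiff

/-- If at least `k R` of the `R` stepdown rejections lie in `I`, then at the first step `j`
for which the values off `I` leave room for `k j` rejections in `I`, at least `k j` of the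
values on `I` are at most `c j`. -/
lemma exists_first_crossing {s : ℕ} (v : Fin s → ℝ) (τ : Equiv.Perm (Fin s))
    (hτ : Monotone fun i => v (τ i)) (I : Finset (Fin s)) (c : ℕ → ℝ)
    (hc : ∀ i j, 1 ≤ i → i ≤ j → j ≤ s → c i ≤ c j) (k : ℕ → ℕ) {R : ℕ} (hR0 : 1 ≤ R)
    (hR : R = (Finset.univ.filter
      (fun r : Fin s => ∀ i : Fin s, i ≤ r → v (τ i) ≤ c (i.val + 1))).card)
    (hF : k R ≤ (Finset.univ.filter (fun i : Fin s => i.val < R ∧ τ i ∈ I)).card) :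
    ∃ j, 1 ≤ j ∧ j ≤ s ∧
      (((Finset.univ \ I).filter fun i => v i ≤ c j).card + k j ≤ j ∧
        ∀ j', 1 ≤ j' → j' < j →
          j' < ((Finset.univ \ I).filter fun i => v i ≤ c j').card + k j') ∧
      k j ≤ (I.filter fun i => v i ≤ c j).card := by
  classical
  have hmem : ∀ r : Fin s, r.val < R ↔ ∀ i : Fin s, i ≤ r → v (τ i) ≤ c (i.val + 1) := by
    intro r
    rw [hR, ← mem_iff_val_lt_card_of_isLowerSet]
    · simp
    · intro a b hba ha
      simp only [Finset.coe_filter, Finset.mem_univ, true_and, Set.mem_ofPred_eq] at ha ⊢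
      exact fun i hi => ha i (hi.trans hba)
  have hRs : R ≤ s := by
    rw [hR]
    exact (Finset.card_le_univ _).trans (by simp)
  have hle : ∀ j, 1 ≤ j → j ≤ R → ∀ i : Fin s, i.val < j → v (τ i) ≤ c j := fun j hj hjR i hi =>
    ((hmem i).1 (by omega) i le_rfl).trans (hc _ _ (by omega) (by omega) (by omega))
  have hcount : ∀ j, 1 ≤ j → j ≤ R →
      j ≤ (Finset.univ.filter fun i => v (τ i) ≤ c j).card := by
    intro j hj hjR
    conv_lhs => rw [← Fin.card_filter_val_lt_of_le (hjR.trans hRs)]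
    apply Finset.card_le_card
    intro i hi
    simp only [Finset.mem_filter, Finset.mem_univ, true_and] at hi ⊢
    exact hle j hj hjR i hi
  have hgt : ∀ i : Fin s, v (τ i) ≤ c R → i.val < R := by
    intro i hi
    by_contra hiR
    push Not at hiR
    have hRs' : R < s := by omega
    have h := (hmem ⟨R, hRs'⟩).not.1 (by simp)
    push Not at h
    obtain ⟨l, hl, hl'⟩ := h
    have hlR : l.val = R := by
      rcases lt_or_eq_of_le (show l.val ≤ R from hl) with h | h
      · exact absurd ((hmem l).1 h l le_rfl) (not_le.2 hl')
      · exact h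
    have h1 : v (τ l) ≤ v (τ i) := hτ (show l.val ≤ i.val by omega)
    have h2 := hc R (l.val + 1) hR0 (by omega) (by omega)
    linarith
  have hQR : ((Finset.univ \ I).filter fun i => v i ≤ c R).card + k R ≤ R := by
    have h1 : (Finset.univ.filter (fun i : Fin s => i.val < R ∧ τ i ∈ I)).card ≤
        (I.filter fun i => v i ≤ c R).card := by
      apply Finset.card_le_card_of_injOn τ
      · intro i hi
        simp only [Finset.coe_filter, Finset.mem_univ, true_and, Set.mem_ofPred_eq] at hi ⊢
        exact ⟨hi.2, hle R hR0 le_rfl i hi.1⟩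
      · exact τ.injective.injOn
    have h2 := card_filter_add_card_filter_sdiff v τ I (c R)
    have h3 : (Finset.univ.filter fun i => v (τ i) ≤ c R).card ≤ R := by
      conv_rhs => rw [← Fin.card_filter_val_lt_of_le hRs]
      apply Finset.card_le_card
      intro i hi
      simp only [Finset.mem_filter, Finset.mem_univ, true_and] at hi ⊢
      exact hgt i hi
    omega
  have hex : ∃ j, 1 ≤ j ∧ ((Finset.univ \ I).filter fun i => v i ≤ c j).card + k j ≤ j :=
    ⟨R, hR0, hQR⟩
  obtain ⟨hj1, hjQ⟩ := Nat.find_spec hex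
  have hjR : Nat.find hex ≤ R := Nat.find_min' hex ⟨hR0, hQR⟩
  have hmin : ∀ j', 1 ≤ j' → j' < Nat.find hex →
      j' < ((Finset.univ \ I).filter fun i => v i ≤ c j').card + k j' := fun j' h1 h2 => by
    have := Nat.find_min hex h2
    push Not at this
    exact this h1
  generalize Nat.find hex = j at hj1 hjQ hjR hmin
  refine ⟨j, hj1, hjR.trans hRs, ⟨hjQ, hmin⟩, ?_⟩
  have h1 := card_filter_add_card_filter_sdiff v τ I (c j)
  have h2 := hcount j hj1 hjR
  omega

lemma measurable_card_filter_le {Ω ι : Type*} [MeasurableSpace Ω] (T : Finset ι)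
    (q : ι → Ω → ℝ) (hq : ∀ i ∈ T, Measurable (q i)) (u : ℝ) :
    Measurable fun ω => (T.filter fun i => q i ω ≤ u).card := by
  simp_rw [Finset.card_filter]
  exact Finset.measurable_fun_sum _ fun i hi =>
    Measurable.ite (measurableSet_le (hq i hi) measurable_const) measurable_const
      measurable_const

lemma measurableSet_first_crossing {Ω ι : Type*} [MeasurableSpace Ω] (T : Finset ι)
    (q : ι → Ω → ℝ) (hq : ∀ i ∈ T, Measurable (q i)) (c : ℕ → ℝ) (k : ℕ → ℕ) (j : ℕ) :
    MeasurableSet {ω | (T.filter fun i => q i ω ≤ c j).card + k j ≤ j ∧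
      ∀ j', 1 ≤ j' → j' < j → j' < (T.filter fun i => q i ω ≤ c j').card + k j'} := by
  have hm := fun u => measurable_card_filter_le T q hq u
  simp_rw [Set.ofPred_and, Set.ofPred_forall]
  refine MeasurableSet.inter ?_ ?_
  · exact measurableSet_le ((hm _).add_const _) measurable_const
  · refine MeasurableSet.iInter fun j' => MeasurableSet.iInter fun _ =>
      MeasurableSet.iInter fun _ => ?_
    exact measurableSet_lt measurable_const ((hm _).add_const _)

/-- Markov's inequality for the number of indices with `p i ω ≤ u`, on an event `A`. -/
lemma mul_measure_card_filter_le {Ω ι : Type*} [MeasurableSpace Ω] (P : Measure Ω)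
    (I : Finset ι) (p : ι → Ω → ℝ) (hp : ∀ i, Measurable (p i)) (u : ℝ) (k : ℕ)
    {A : Set Ω} (hA : MeasurableSet A) :
    (k : ENNReal) * P {ω | ω ∈ A ∧ k ≤ (I.filter fun i => p i ω ≤ u).card} ≤
      ∑ i ∈ I, P ({ω | p i ω ≤ u} ∩ A) := by
  have hS : ∀ i, MeasurableSet ({ω | p i ω ≤ u} ∩ A) := fun i =>
    (measurableSet_le (hp i) measurable_const).inter hA
  have hint : ∫⁻ ω, ∑ i ∈ I, ({ω | p i ω ≤ u} ∩ A).indicator 1 ω ∂P =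
      ∑ i ∈ I, P ({ω | p i ω ≤ u} ∩ A) := by
    rw [lintegral_finsetSum _ fun i _ => measurable_one.indicator (hS i)]
    exact Finset.sum_congr rfl fun i _ => lintegral_indicator_one (hS i)
  rw [← hint]
  refine le_trans ?_ (mul_meas_ge_le_lintegral
    (Finset.measurable_fun_sum _ fun i _ => measurable_one.indicator (hS i)) (k : ENNReal))
  gcongr with ω
  rintro ⟨hωA, hω⟩
  have : (∑ i ∈ I, ({ω | p i ω ≤ u} ∩ A).indicator (1 : Ω → ENNReal) ω) =
      ((I.filter fun i => p i ω ≤ u).card : ENNReal) := by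
    rw [Finset.card_filter]
    push_cast
    refine Finset.sum_congr rfl fun i _ => ?_
    by_cases h : p i ω ≤ u <;> simp [h, hωA]
  rw [this]
  exact_mod_cast hω

/-- A first crossing occurs exactly at the boundary, so there are at least `j - k j` indices
in `T`. -/
lemma le_card_add_of_first_crossing {ι : Type*} (T : Finset ι) (v : ι → ℝ) (c : ℕ → ℝ)
    (k : ℕ → ℕ) (hk1 : k 1 = 1) (hk : ∀ j, k j ≤ k (j + 1)) {j : ℕ} (hj : 1 ≤ j)
    (h : ∀ j', 1 ≤ j' → j' < j → j' < (T.filter fun i => v i ≤ c j').card + k j') :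
    j ≤ T.card + k j := by
  obtain rfl | ⟨j, rfl⟩ : j = 1 ∨ ∃ i, j = i + 2 := by
    rcases j with _ | _ | j
    · omega
    · simp
    · exact Or.inr ⟨j, rfl⟩
  · omega
  · have h1 := h (j + 1) (by omega) (by omega)
    have h2 : (T.filter fun i => v i ≤ c (j + 1)).card ≤ T.card := Finset.card_filter_le _ _
    have h3 : k (j + 1) ≤ k (j + 2) := hk (j + 1)
    omega


/-- Theorem 3.1 of Lehmann–Romano: if, conditionally on the σ-algebra generated by
the p-values of the false null hypotheses, each true-null p-value is dominated by the
uniform distribution, then the stepdown procedure with constants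
`α_i = (⌊γ i⌋ + 1)α/(s + ⌊γ i⌋ + 1 − i)` satisfies `P{FDP > γ} ≤ α`. -/
theorem stepdown_controls_FDP
    {Ω : Type*} [MeasurableSpace Ω] (P : Measure Ω) [IsProbabilityMeasure P]
    (s : ℕ) (hs : 1 ≤ s) (p : Fin s → Ω → ℝ)
    (hmeas : ∀ i, Measurable (p i)) (hrange : ∀ i ω, p i ω ∈ Set.Icc (0:ℝ) 1)
    (I : Finset (Fin s)) (γ α : ℝ) (hγ : γ ∈ Set.Ioo (0:ℝ) 1) (hα : α ∈ Set.Ioo (0:ℝ) 1)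
    (hcond : ∀ i ∈ I, ∀ u ∈ Set.Ioo (0:ℝ) 1, ∀ A : Set Ω,
      MeasurableSet[⨆ j ∈ Finset.univ \ I,
        MeasurableSpace.comap (p j) inferInstance] A →
      P ({ω | p i ω ≤ u} ∩ A) ≤ ENNReal.ofReal u * P A)
    (c : ℕ → ℝ)
    (hc : ∀ i, 1 ≤ i → i ≤ s →
      c i = (((⌊γ * (i : ℝ)⌋ : ℤ) : ℝ) + 1) * α /
        ((s : ℝ) + ((⌊γ * (i : ℝ)⌋ : ℤ) : ℝ) + 1 - (i : ℝ)))
    (σ : Ω → Equiv.Perm (Fin s))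
    (hσmono : ∀ ω, Monotone fun i => p (σ ω i) ω)
    (hσmeas : ∀ i : Fin s, Measurable fun ω => σ ω i)
    (R : Ω → ℕ)
    (hR : ∀ ω, R ω = (Finset.univ.filter
      (fun r : Fin s => ∀ i : Fin s, i ≤ r → p (σ ω i) ω ≤ c (i.val + 1))).card)
    (F : Ω → ℕ)
    (hF : ∀ ω, F ω = (Finset.univ.filter
      (fun i : Fin s => i.val < R ω ∧ σ ω i ∈ I)).card) :
    P {ω | γ < (F ω : ℝ) / (R ω : ℝ)} ≤ ENNReal.ofReal α := by
  classical
  obtain ⟨hγ0, hγ1⟩ := hγ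
  obtain ⟨hα0, hα1⟩ := hα
  set k : ℕ → ℕ := fun j => ⌊γ * (j : ℝ)⌋₊ + 1 with hkdef
  have hk1 : k 1 = 1 := by
    simpa [hkdef, Nat.floor_eq_zero] using hγ1
  have hkmono : ∀ j, k j ≤ k (j + 1) := by
    intro j
    simp only [hkdef]
    gcongr
    omega
  have hkpos : ∀ j, 1 ≤ k j := fun j => by simp [hkdef]
  have hkstep : ∀ j, k (j + 1) ≤ k j + 1 := by
    intro j
    simp only [hkdef]
    have h : ⌊γ * ((j + 1 : ℕ) : ℝ)⌋₊ ≤ ⌊γ * (j : ℝ) + 1⌋₊ := by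
      apply Nat.floor_le_floor
      push_cast
      linarith
    rw [Nat.floor_add_one (by positivity)] at h
    omega
  have hck : ∀ i, 1 ≤ i → i ≤ s → c i = (k i : ℝ) * α / (((s - i : ℕ) : ℝ) + k i) := by
    intro i h1 h2
    have hfl : ((⌊γ * (i : ℝ)⌋ : ℤ) : ℝ) = (⌊γ * (i : ℝ)⌋₊ : ℝ) :=
      (natCast_floor_eq_intCast_floor (by positivity)).symm
    rw [hc i h1 h2, hfl, Nat.cast_sub h2]
    simp only [hkdef]
    push_cast
    congr 1
    ring
  have hkR : ∀ i, (0 : ℝ) < k i := fun i => by exact_mod_cast hkpos i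
  have hcIoo : ∀ i, 1 ≤ i → i ≤ s → c i ∈ Set.Ioo (0 : ℝ) 1 := by
    intro i h1 h2
    have := hkR i
    rw [hck i h1 h2]
    refine ⟨by positivity, ?_⟩
    rw [div_lt_one (by positivity)]
    have : (0 : ℝ) ≤ ((s - i : ℕ) : ℝ) := by positivity
    nlinarith
  have hcsucc : ∀ i, 1 ≤ i → i + 1 ≤ s → c i ≤ c (i + 1) := by
    intro i h1 h2
    have hki := hkR i
    rw [hck i h1 (by omega), hck (i + 1) (by omega) h2,
      show s - i = s - (i + 1) + 1 by omega]
    have hkk : k (i + 1) = k i ∨ k (i + 1) = k i + 1 := by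
      have := hkmono i
      have := hkstep i
      omega
    rcases hkk with h | h <;> rw [h] <;> push_cast
    · gcongr
      linarith
    · rw [add_assoc, add_comm (1 : ℝ)]
      gcongr
      linarith
  have hcmono : ∀ i j, 1 ≤ i → i ≤ j → j ≤ s → c i ≤ c j := by
    intro i j h1 hij
    induction j, hij using Nat.le_induction with
    | base => exact fun _ => le_rfl
    | succ j hij ih => exact fun hj => (ih (by omega)).trans (hcsucc j (by omega) hj)
  set A : ℕ → Set Ω := fun j =>
    {ω | ((Finset.univ \ I).filter fun i => p i ω ≤ c j).card + k j ≤ j ∧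
      ∀ j', 1 ≤ j' → j' < j →
        j' < ((Finset.univ \ I).filter fun i => p i ω ≤ c j').card + k j'} with hAdef
  have hA : ∀ j, MeasurableSet (A j) := fun j =>
    measurableSet_first_crossing _ p (fun i _ => hmeas i) c k j
  have hA' : ∀ j, MeasurableSet[⨆ j ∈ Finset.univ \ I,
      MeasurableSpace.comap (p j) inferInstance] (A j) := fun j =>
    @measurableSet_first_crossing Ω (Fin s)
      (⨆ j ∈ Finset.univ \ I, MeasurableSpace.comap (p j) inferInstance) _ p
      (fun i hi => Measurable.mono (comap_measurable (p i))
        (le_iSup₂_of_le i hi le_rfl) le_rfl) c k j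
  have hsub : {ω | γ < (F ω : ℝ) / (R ω : ℝ)} ⊆ ⋃ j ∈ Finset.Icc 1 s,
      {ω | ω ∈ A j ∧ k j ≤ (I.filter fun i => p i ω ≤ c j).card} := by
    intro ω hω
    rw [Set.mem_ofPred_eq] at hω
    have hR0 : 1 ≤ R ω := by
      by_contra h
      have : R ω = 0 := by omega
      simp only [this, Nat.cast_zero, div_zero] at hω
      linarith
    have hFk : k (R ω) ≤ F ω := by
      rw [lt_div_iff₀ (by exact_mod_cast hR0), ← Nat.floor_lt (by positivity)] at hω
      exact hω
    rw [hF ω] at hFk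
    obtain ⟨j, hj1, hjs, h1, h2⟩ := exists_first_crossing (fun i => p i ω) (σ ω) (hσmono ω) I c
      hcmono k hR0 (hR ω) hFk
    exact Set.mem_biUnion (Finset.mem_coe.2 (Finset.mem_Icc.2 ⟨hj1, hjs⟩)) ⟨h1, h2⟩
  have hbound : ∀ j ∈ Finset.Icc 1 s,
      P {ω | ω ∈ A j ∧ k j ≤ (I.filter fun i => p i ω ≤ c j).card} ≤
        ENNReal.ofReal α * P (A j) := by
    intro j hj
    obtain ⟨hj1, hjs⟩ := Finset.mem_Icc.1 hj
    rcases (A j).eq_empty_or_nonempty with he | ⟨ω, hω⟩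
    · simp [he]
    have hcard : I.card ≤ s - j + k j := by
      have h1 := le_card_add_of_first_crossing _ (fun i => p i ω) c k hk1 hkmono hj1 hω.2
      have h2 := Finset.card_sdiff_add_card_eq_card (Finset.subset_univ I)
      rw [Finset.card_univ, Fintype.card_fin] at h2
      omega
    have hmul : (I.card : ℝ) * c j ≤ k j * α := by
      have hkj := hkR j
      rw [hck j hj1 hjs, mul_div_assoc', div_le_iff₀ (by positivity), mul_comm]
      gcongr
      exact_mod_cast hcard
    have hmarkov := (mul_measure_card_filter_le P I p hmeas (c j) (k j) (hA j)).trans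
      (Finset.sum_le_sum fun i hi => hcond i hi (c j) (hcIoo j hj1 hjs) (A j) (hA' j))
    rw [Finset.sum_const, nsmul_eq_mul, ← mul_assoc] at hmarkov
    have hmul' : (I.card : ENNReal) * ENNReal.ofReal (c j) ≤ k j * ENNReal.ofReal α := by
      rw [← ENNReal.ofReal_natCast, ← ENNReal.ofReal_natCast,
        ← ENNReal.ofReal_mul (by positivity), ← ENNReal.ofReal_mul (by positivity)]
      exact ENNReal.ofReal_le_ofReal hmul
    have h := hmarkov.trans (mul_le_mul_left hmul' (P (A j)))
    rw [mul_assoc] at h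
    exact (ENNReal.mul_le_mul_iff_right (by simp [hkdef])
      (ENNReal.natCast_ne_top _)).1 h
  have hdisj : Set.PairwiseDisjoint (Finset.Icc 1 s : Set ℕ) A := by
    have key : ∀ i j, 1 ≤ i → i < j → Disjoint (A i) (A j) := fun i j hi hij =>
      Set.disjoint_left.2 fun ω h1 h2 => (h2.2 i hi hij).not_ge h1.1
    intro i hi j hj hij
    rcases lt_or_gt_of_ne hij with h | h
    · exact key i j (Finset.mem_Icc.1 hi).1 h
    · exact (key j i (Finset.mem_Icc.1 hj).1 h).symm
  calc P {ω | γ < (F ω : ℝ) / (R ω : ℝ)}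
      ≤ ∑ j ∈ Finset.Icc 1 s,
          P {ω | ω ∈ A j ∧ k j ≤ (I.filter fun i => p i ω ≤ c j).card} :=
        (measure_mono hsub).trans (measure_biUnion_finset_le _ _)
    _ ≤ ∑ j ∈ Finset.Icc 1 s, ENNReal.ofReal α * P (A j) := Finset.sum_le_sum hbound
    _ = ENNReal.ofReal α * P (⋃ j ∈ Finset.Icc 1 s, A j) := by
        rw [← Finset.mul_sum, measure_biUnion_finset hdisj fun j _ => hA j]
    _ ≤ ENNReal.ofReal α := mul_le_of_le_one_right' prob_le_one
end

section
/- For the stepdown procedure with constants α_i = (⌊γi⌋ + 1)α / (s + ⌊γi⌋ + 1 − i), one has P{FDP > γ} ≤ P{⋃_{i=1}^M {q_(i) ≤ iα/|I|}}, where q_(1) ≤ ⋯ ≤ q_(|I|) are the ordered p-values of the true null hypotheses and M = min(⌊γs⌋ + 1, |I|). -/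
open MeasureTheory Set

lemma orderStat_le_of_lt_countP {l : Multiset ℝ} {n : ℕ} {t : ℝ}
    (h : n < l.countP (· ≤ t)) : orderStat l n ≤ t := by
  unfold orderStat
  have hsort : (l.sort (· ≤ ·)).Pairwise (· ≤ ·) := l.pairwise_sort (· ≤ ·)
  have hcount : n < (l.sort (· ≤ ·)).countP (· ≤ t) := by
    rw [← Multiset.coe_countP, Multiset.sort_eq]
    exact h
  generalize l.sort (· ≤ ·) = L at hsort hcount
  have hn : n < L.length := hcount.trans_le List.countP_le_length
  rw [List.getD_eq_getElem _ _ hn]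
  by_contra! hlt
  have hdrop : (L.drop n).countP (· ≤ t) = 0 := by
    rw [List.countP_eq_zero]
    intro a ha
    obtain ⟨k, hk, rfl⟩ := List.mem_iff_getElem.mp ha
    rw [List.getElem_drop]
    have hle : L[n] ≤ L[n + k]'(by rw [List.length_drop] at hk; omega) := by
      rcases Nat.eq_zero_or_pos k with rfl | hpos
      · simp
      · exact List.pairwise_iff_getElem.mp hsort _ _ _ _ (by omega)
    simpa using hlt.trans_le hle
  have htake : (L.take n).countP (· ≤ t) ≤ n :=
    List.countP_le_length.trans (List.length_take_le n L)
  rw [← List.take_append_drop n L, List.countP_append, hdrop] at hcount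
  omega

lemma Fin.of_lt_card_filter_of_forall_le {s : ℕ} (Q : Fin s → Prop) [DecidablePred Q]
    [DecidablePred fun r : Fin s => ∀ i ≤ r, Q i] (k : Fin s)
    (h : k.val < (Finset.univ.filter fun r : Fin s => ∀ i ≤ r, Q i).card) : Q k := by
  by_contra hk
  have hsub : (Finset.univ.filter fun r : Fin s => ∀ i ≤ r, Q i) ⊆ Finset.Iio k := by
    intro r hr
    rw [Finset.mem_filter] at hr
    exact Finset.mem_Iio.mpr (lt_of_not_ge fun hle => hk (hr.2 k hle))
  have := Finset.card_le_card hsub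
  rw [Fin.card_Iio] at this
  omega

/-- The number of indices in `I` among the first `j` values of the permutation `τ`. -/
def hitsBefore {s : ℕ} (τ : Equiv.Perm (Fin s)) (I : Finset (Fin s)) (j : ℕ) : ℕ :=
  (Finset.univ.filter fun i : Fin s => i.val < j ∧ τ i ∈ I).card

section hitsBefore

variable {s : ℕ} (τ : Equiv.Perm (Fin s)) (I : Finset (Fin s))

lemma hitsBefore_zero : hitsBefore τ I 0 = 0 := by
  simp [hitsBefore]

lemma hitsBefore_succ_le {k : ℕ} (hk : k < s) :
    hitsBefore τ I (k + 1) ≤ hitsBefore τ I k + 1 := by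
  refine (Finset.card_le_card ?_).trans (Finset.card_insert_le (⟨k, hk⟩ : Fin s) _)
  intro i
  simp only [Finset.mem_filter, Finset.mem_insert, Finset.mem_univ, true_and, Fin.ext_iff]
  rintro ⟨h, hI⟩
  rcases Nat.lt_succ_iff_lt_or_eq.mp h with h | h
  · exact Or.inr ⟨h, hI⟩
  · exact Or.inl h

lemma card_filter_perm_mem : (Finset.univ.filter fun i => τ i ∈ I).card = I.card :=
  Finset.card_bij (fun i _ => τ i) (by simp) (by simp)
    fun b hb => ⟨τ.symm b, by simpa using hb, by simp⟩

lemma hitsBefore_le_card (j : ℕ) : hitsBefore τ I j ≤ I.card := by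
  rw [← card_filter_perm_mem τ I]
  exact Finset.card_le_card (Finset.monotone_filter_right _ fun _ _ h => h.2)

lemma card_add_le_hitsBefore_add {j : ℕ} (hj : j ≤ s) :
    I.card + j ≤ hitsBefore τ I j + s := by
  have hcompl : (Finset.univ.filter fun i : Fin s => ¬ i.val < j).card + j = s := by
    have h := Finset.card_filter_add_card_filter_not (s := (Finset.univ : Finset (Fin s)))
      (fun i : Fin s => i.val < j)
    rw [Fin.card_filter_val_lt, Finset.card_univ, Fintype.card_fin, min_eq_right hj] at h
    omega
  have hsub : (Finset.univ.filter fun i => τ i ∈ I).card ≤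
      hitsBefore τ I j + (Finset.univ.filter fun i : Fin s => ¬ i.val < j).card := by
    refine (Finset.card_le_card ?_).trans (Finset.card_union_le _ _)
    intro i
    simp only [Finset.mem_filter, Finset.mem_union, Finset.mem_univ, true_and]
    tauto
  rw [card_filter_perm_mem] at hsub
  omega

lemma hitsBefore_le_countP {x : Fin s → ℝ} (hx : Monotone fun i => x (τ i)) (k : Fin s)
    {t : ℝ} (ht : x (τ k) ≤ t) :
    hitsBefore τ I (k.val + 1) ≤ (Multiset.map x I.val).countP (· ≤ t) := by
  rw [Multiset.countP_map]
  change _ ≤ (I.filter fun i => x i ≤ t).card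
  refine Finset.card_le_card_of_injOn τ ?_ τ.injective.injOn
  intro i hi
  simp only [Finset.coe_filter, Set.mem_ofPred_eq, Finset.mem_univ, true_and] at hi ⊢
  exact ⟨hi.2, (hx (Fin.le_def.mpr (by omega))).trans ht⟩

/-- At the first time the proportion of hits exceeds `γ`, the number of hits is
`⌊γ j⌋ + 1`. -/
lemma exists_hitsBefore_eq_floor_add_one {γ : ℝ} (hγ : 0 < γ) {r : ℕ} (hr : r ≤ s)
    (h : γ * r < hitsBefore τ I r) :
    ∃ k < r, hitsBefore τ I (k + 1) = ⌊γ * ((k + 1 : ℕ) : ℝ)⌋₊ + 1 := by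
  classical
  have hex : ∃ j : ℕ, γ * j < hitsBefore τ I j := ⟨r, h⟩
  have hspec := Nat.find_spec hex
  have hle : Nat.find hex ≤ r := Nat.find_min' hex h
  have hmin : ∀ j < Nat.find hex, _ := fun j => Nat.find_min hex
  generalize Nat.find hex = j at hspec hle hmin
  cases j with
  | zero => simp [hitsBefore_zero] at hspec
  | succ k =>
    refine ⟨k, hle, le_antisymm ?_ ((Nat.floor_lt (by positivity)).mpr hspec)⟩
    refine (hitsBefore_succ_le τ I (hle.trans hr)).trans (Nat.succ_le_succ (Nat.le_floor ?_))
    refine (not_lt.mp (hmin k k.lt_succ_self)).trans ?_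
    gcongr
    exact k.le_succ

end hitsBefore

/-- Theorem 3.2(i) of Lehmann–Romano: for the stepdown procedure with constants
`α_i = (⌊γ i⌋ + 1)α/(s + ⌊γ i⌋ + 1 − i)`,
`P{FDP > γ} ≤ P(⋃_{i=1}^M {q_(i) ≤ iα/|I|})`, where `q_(1) ≤ ⋯ ≤ q_(|I|)` are the
ordered p-values of the true null hypotheses and `M = min(⌊γ s⌋ + 1, |I|)`. -/
theorem stepdown_FDP_union_bound
    {Ω : Type*} [MeasurableSpace Ω] (P : Measure Ω) [IsProbabilityMeasure P]
    (s : ℕ) (hs : 1 ≤ s) (p : Fin s → Ω → ℝ)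
    (hmeas : ∀ i, Measurable (p i)) (hrange : ∀ i ω, p i ω ∈ Set.Icc (0:ℝ) 1)
    (I : Finset (Fin s)) (hIne : I.Nonempty)
    (γ α : ℝ) (hγ : γ ∈ Set.Ioo (0:ℝ) 1) (hα : α ∈ Set.Ioo (0:ℝ) 1)
    (c : ℕ → ℝ)
    (hc : ∀ i, 1 ≤ i → i ≤ s →
      c i = (((⌊γ * (i : ℝ)⌋ : ℤ) : ℝ) + 1) * α /
        ((s : ℝ) + ((⌊γ * (i : ℝ)⌋ : ℤ) : ℝ) + 1 - (i : ℝ)))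
    (σ : Ω → Equiv.Perm (Fin s))
    (hσmono : ∀ ω, Monotone fun i => p (σ ω i) ω)
    (hσmeas : ∀ i : Fin s, Measurable fun ω => σ ω i)
    (R : Ω → ℕ)
    (hR : ∀ ω, R ω = (Finset.univ.filter
      (fun r : Fin s => ∀ i : Fin s, i ≤ r → p (σ ω i) ω ≤ c (i.val + 1))).card)
    (F : Ω → ℕ)
    (hF : ∀ ω, F ω = (Finset.univ.filter
      (fun i : Fin s => i.val < R ω ∧ σ ω i ∈ I)).card) :
    P {ω | γ < (F ω : ℝ) / (R ω : ℝ)} ≤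
      P {ω | ∃ m, 1 ≤ m ∧ m ≤ min (⌊γ * (s : ℝ)⌋₊ + 1) I.card ∧
        orderStat (Multiset.map (fun i => p i ω) I.val) (m - 1) ≤
          (m : ℝ) * α / (I.card : ℝ)} := by
  refine measure_mono fun ω hω => ?_
  obtain ⟨hγ0, -⟩ := hγ
  obtain ⟨hα0, -⟩ := hα
  have hRs : R ω ≤ s := by
    rw [hR]
    exact (Finset.card_le_univ _).trans_eq (Fintype.card_fin s)
  have hFω : F ω = hitsBefore (σ ω) I (R ω) := hF ω
  have hexceed : γ * R ω < hitsBefore (σ ω) I (R ω) := by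
    rw [Set.mem_ofPred_eq, hFω] at hω
    have hRpos : (0 : ℝ) < R ω := by
      rcases (R ω).eq_zero_or_pos with h | h
      · rw [h] at hω
        simp only [Nat.cast_zero, div_zero] at hω
        exact absurd hω hγ0.le.not_gt
      · exact_mod_cast h
    exact (lt_div_iff₀ hRpos).mp hω
  obtain ⟨k, hkR, hm⟩ := exists_hitsBefore_eq_floor_add_one (σ ω) I hγ0 hRs hexceed
  have hks : k < s := hkR.trans_le hRs
  have hreject : p (σ ω ⟨k, hks⟩) ω ≤ c (k + 1) :=
    Fin.of_lt_card_filter_of_forall_le (fun i => p (σ ω i) ω ≤ c (i.val + 1)) ⟨k, hks⟩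
      (hkR.trans_eq (hR ω))
  have hcrit : c (k + 1) ≤ (hitsBefore (σ ω) I (k + 1) : ℝ) * α / (I.card : ℝ) := by
    have hfloor : (((⌊γ * ((k + 1 : ℕ) : ℝ)⌋ : ℤ) : ℝ)) + 1 = hitsBefore (σ ω) I (k + 1) := by
      rw [hm, ← natCast_floor_eq_intCast_floor (by positivity)]
      push_cast
      rfl
    have hcard : (I.card : ℝ) + (k + 1 : ℕ) ≤ hitsBefore (σ ω) I (k + 1) + s := by
      exact_mod_cast card_add_le_hitsBefore_add (σ ω) I (Nat.succ_le_of_lt hks)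
    have hIpos : (0 : ℝ) < I.card := by exact_mod_cast hIne.card_pos
    rw [hc (k + 1) (by omega) hks, hfloor]
    exact div_le_div_of_nonneg_left (by positivity) hIpos (by linarith)
  refine ⟨hitsBefore (σ ω) I (k + 1), by omega,
    le_min ?_ (hitsBefore_le_card (σ ω) I (k + 1)), ?_⟩
  · rw [hm]
    gcongr
    exact hks
  · have hcount := hitsBefore_le_countP (σ ω) I (x := fun i => p i ω) (hσmono ω) ⟨k, hks⟩
      (hreject.trans hcrit)
    exact orderStat_le_of_lt_countP ((Nat.sub_lt (by omega) one_pos).trans_le hcount)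
end

section
/- Suppose the ordered p-values q_(1) ≤ ⋯ ≤ q_(|I|) of the true null hypotheses satisfy the Simes inequality P{⋃_{i=1}^{|I|} {q_(i) ≤ iα/|I|}} ≤ α. Then the stepdown procedure with constants α_i = (⌊γi⌋ + 1)α / (s + ⌊γi⌋ + 1 − i) satisfies P{FDP > γ} ≤ α. -/
open MeasureTheory Set

/-- If at least `k + 1` elements of `l` are at most `x`, then the `k`-th order statistic
(0-indexed) is at most `x`. -/
theorem orderStat_le_of_lt_card_filter (l : Multiset ℝ) (k : ℕ) (x : ℝ)
    (h : k < (l.filter (· ≤ x)).card) : orderStat l k ≤ x := by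
  by_contra! hx
  have hfil : (l.filter (· ≤ x)).card = ((l.sort (· ≤ ·)).filter (· ≤ x)).length := by
    conv_lhs => rw [← Multiset.sort_eq l (· ≤ ·)]
    rw [Multiset.filter_coe, Multiset.coe_card]
  have hlen : k < (l.sort (· ≤ ·)).length := by
    have := List.length_filter_le (fun a => decide (a ≤ x)) (l.sort (· ≤ ·))
    omega
  have hs : (l.sort (· ≤ ·)).Pairwise (· ≤ ·) := Multiset.pairwise_sort l (· ≤ ·)
  rw [orderStat] at hx
  generalize l.sort (· ≤ ·) = L at *
  rw [List.getD_eq_getElem _ _ hlen] at hx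
  have hdrop : (L.drop k).filter (· ≤ x) = [] := by
    rw [List.filter_eq_nil_iff]
    intro a ha
    obtain ⟨n, hn, rfl⟩ := List.mem_iff_getElem.mp ha
    rw [List.length_drop] at hn
    have hle : L[k] ≤ L[k + n] := by
      rcases Nat.eq_zero_or_pos n with rfl | hpos
      · simp
      · exact List.pairwise_iff_getElem.mp hs k (k + n) hlen (by omega) (by omega)
    simpa using hx.trans_le hle
  have hle : (L.filter (· ≤ x)).length ≤ k := by
    conv_lhs => rw [← List.take_append_drop k L, List.filter_append, hdrop, List.append_nil]
    exact (List.length_filter_le _ _).trans (List.length_take_le _ _)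
  omega

/-- An initial segment of `Fin s` contains every index below its cardinality. -/
theorem Fin.forall_le_of_lt_card_filter {s : ℕ} (Q : Fin s → Prop) [DecidablePred Q] (j : Fin s)
    (hj : j.val < (Finset.univ.filter (fun r : Fin s => ∀ i : Fin s, i ≤ r → Q i)).card) :
    Q j := by
  by_contra hQ
  have hsub : Finset.univ.filter (fun r : Fin s => ∀ i : Fin s, i ≤ r → Q i) ⊆ Finset.Iio j := by
    intro r hr
    rw [Finset.mem_filter] at hr
    rw [Finset.mem_Iio]
    by_contra! hjr
    exact hQ (hr.2 j hjr)
  have := Finset.card_le_card hsub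
  rw [Fin.card_Iio] at this
  omega

/-- A 0/1-increment counting function that exceeds `γ r` at `r` has a first such crossing `j + 1`,
where its value is exactly `⌊γ (j + 1)⌋ + 1`. -/
theorem exists_first_crossing_s12 (N : ℕ → ℕ) (h0 : N 0 = 0) (hstep : ∀ n, N (n + 1) ≤ N n + 1)
    (γ : ℝ) (hγ : 0 ≤ γ) (r : ℕ) (hr : γ * r < N r) :
    ∃ j < r, (⌊γ * ((j + 1 : ℕ) : ℝ)⌋ : ℤ) + 1 = N (j + 1) := by
  classical
  have hex : ∃ n : ℕ, γ * n < N n := ⟨r, hr⟩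
  obtain ⟨j, hj⟩ : ∃ j, Nat.find hex = j + 1 := by
    refine Nat.exists_eq_succ_of_ne_zero fun h => ?_
    have := Nat.find_spec hex
    simp [h, h0] at this
  have hspec : γ * ((j + 1 : ℕ) : ℝ) < N (j + 1) := hj ▸ Nat.find_spec hex
  have hmin : (N j : ℝ) ≤ γ * j := not_lt.mp (Nat.find_min hex (by omega))
  refine ⟨j, by have := Nat.find_le (h := hex) hr; omega, ?_⟩
  have hlo : ⌊γ * ((j + 1 : ℕ) : ℝ)⌋ < (N (j + 1) : ℤ) :=
    Int.floor_lt.mpr (by exact_mod_cast hspec)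
  have hhi : (N j : ℤ) ≤ ⌊γ * ((j + 1 : ℕ) : ℝ)⌋ := by
    refine Int.le_floor.mpr ?_
    push_cast
    linarith
  have := hstep j
  omega

/-- Theorem 3.2(ii) of Lehmann–Romano: if the ordered p-values of the true null
hypotheses satisfy the Simes inequality, then the stepdown procedure with constants
`α_i = (⌊γ i⌋ + 1)α/(s + ⌊γ i⌋ + 1 − i)` satisfies `P{FDP > γ} ≤ α`. -/
theorem stepdown_FDP_control_under_Simes
    {Ω : Type*} [MeasurableSpace Ω] (P : Measure Ω) [IsProbabilityMeasure P]
    (s : ℕ) (hs : 1 ≤ s) (p : Fin s → Ω → ℝ)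
    (hmeas : ∀ i, Measurable (p i)) (hrange : ∀ i ω, p i ω ∈ Set.Icc (0:ℝ) 1)
    (I : Finset (Fin s)) (hIne : I.Nonempty)
    (γ α : ℝ) (hγ : γ ∈ Set.Ioo (0:ℝ) 1) (hα : α ∈ Set.Ioo (0:ℝ) 1)
    (hSimes : P {ω | ∃ m, 1 ≤ m ∧ m ≤ I.card ∧
        orderStat (Multiset.map (fun i => p i ω) I.val) (m - 1) ≤
          (m : ℝ) * α / (I.card : ℝ)} ≤ ENNReal.ofReal α)
    (c : ℕ → ℝ)
    (hc : ∀ i, 1 ≤ i → i ≤ s →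
      c i = (((⌊γ * (i : ℝ)⌋ : ℤ) : ℝ) + 1) * α /
        ((s : ℝ) + ((⌊γ * (i : ℝ)⌋ : ℤ) : ℝ) + 1 - (i : ℝ)))
    (σ : Ω → Equiv.Perm (Fin s))
    (hσmono : ∀ ω, Monotone fun i => p (σ ω i) ω)
    (hσmeas : ∀ i : Fin s, Measurable fun ω => σ ω i)
    (R : Ω → ℕ)
    (hR : ∀ ω, R ω = (Finset.univ.filter
      (fun r : Fin s => ∀ i : Fin s, i ≤ r → p (σ ω i) ω ≤ c (i.val + 1))).card)
    (F : Ω → ℕ)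
    (hF : ∀ ω, F ω = (Finset.univ.filter
      (fun i : Fin s => i.val < R ω ∧ σ ω i ∈ I)).card) :
    P {ω | γ < (F ω : ℝ) / (R ω : ℝ)} ≤ ENNReal.ofReal α := by
  refine (measure_mono fun ω hω => ?_).trans hSimes
  rw [Set.mem_ofPred_eq] at hω ⊢
  set N : ℕ → ℕ := fun n => (Finset.univ.filter
    (fun i : Fin s => i.val < n ∧ σ ω i ∈ I)).card with hN
  have hRs : R ω ≤ s := by
    rw [hR ω]
    exact (Finset.card_le_univ _).trans (by simp)
  have hcross : γ * (R ω : ℝ) < N (R ω) := by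
    have hpos : (0 : ℝ) < R ω := by
      rcases Nat.eq_zero_or_pos (R ω) with h | h
      · rw [h, Nat.cast_zero, div_zero] at hω
        exact absurd hω hγ.1.le.not_gt
      · exact_mod_cast h
    rw [lt_div_iff₀ hpos, hF ω] at hω
    exact hω
  have hstep : ∀ n, N (n + 1) ≤ N n + 1 := by
    intro n
    have hsub : Finset.univ.filter (fun i : Fin s => i.val < n + 1 ∧ σ ω i ∈ I) ⊆
        Finset.univ.filter (fun i : Fin s => i.val < n ∧ σ ω i ∈ I) ∪
          Finset.univ.filter (fun i : Fin s => i.val = n) := by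
      intro i
      simp only [Finset.mem_filter, Finset.mem_union, Finset.mem_univ, true_and]
      rintro ⟨h, hi⟩
      rcases Nat.lt_succ_iff_lt_or_eq.mp h with h | h
      · exact Or.inl ⟨h, hi⟩
      · exact Or.inr h
    refine (Finset.card_le_card hsub).trans ((Finset.card_union_le _ _).trans ?_)
    gcongr
    refine Finset.card_le_one.mpr fun a ha b hb => Fin.ext ?_
    simp only [Finset.mem_filter, Finset.mem_univ, true_and] at ha hb
    omega
  obtain ⟨j, hjR, hj⟩ := exists_first_crossing_s12 N (by simp [hN]) hstep γ hγ.1.le (R ω) hcross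
  have hfloor : (0 : ℤ) ≤ ⌊γ * ((j + 1 : ℕ) : ℝ)⌋ :=
    Int.floor_nonneg.mpr (mul_nonneg hγ.1.le (Nat.cast_nonneg _))
  have hjs : j < s := hjR.trans_le hRs
  have himage : (Finset.univ.filter (fun i : Fin s => i.val < j + 1 ∧ σ ω i ∈ I)).map
      (σ ω).toEmbedding ⊆ I.filter (fun i => p i ω ≤ p (σ ω ⟨j, hjs⟩) ω) := by
    intro a ha
    simp only [Finset.mem_map, Finset.mem_filter, Finset.mem_univ, true_and] at ha ⊢
    obtain ⟨i, ⟨hij, hi⟩, rfl⟩ := ha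
    exact ⟨hi, hσmono ω (Fin.mk_le_mk.mpr (Nat.lt_succ_iff.mp hij) : i ≤ ⟨j, hjs⟩)⟩
  have hNle : N (j + 1) ≤ (I.filter (fun i => p i ω ≤ p (σ ω ⟨j, hjs⟩) ω)).card := by
    simpa [hN] using Finset.card_le_card himage
  have hcardI : I.card + j + 1 ≤ N (j + 1) + s := by
    have hsub : I.map (σ ω).symm.toEmbedding ⊆
        Finset.univ.filter (fun i : Fin s => i.val < j + 1 ∧ σ ω i ∈ I) ∪
          Finset.Ioi (⟨j, hjs⟩ : Fin s) := by
      intro a ha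
      simp only [Finset.mem_map, Finset.mem_filter, Finset.mem_univ, true_and, Finset.mem_union,
        Finset.mem_Ioi] at ha ⊢
      obtain ⟨i, hi, rfl⟩ := ha
      by_cases h : ((σ ω).symm i).val < j + 1
      · exact Or.inl ⟨h, by simpa using hi⟩
      · exact Or.inr (Fin.lt_def.mpr (by simp at h ⊢; omega))
    have h := (Finset.card_le_card hsub).trans (Finset.card_union_le _ _)
    rw [Finset.card_map, Fin.card_Ioi] at h
    change I.card ≤ N (j + 1) + _ at h
    simp only at h
    omega
  have hp : p (σ ω ⟨j, hjs⟩) ω ≤ c (j + 1) := by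
    refine Fin.forall_le_of_lt_card_filter (fun i : Fin s => p (σ ω i) ω ≤ c (i.val + 1))
      ⟨j, hjs⟩ ?_
    rw [← hR ω]
    exact hjR
  have hIpos : (0 : ℝ) < I.card := by exact_mod_cast hIne.card_pos
  refine ⟨N (j + 1), by omega, hNle.trans (Finset.card_filter_le _ _), ?_⟩
  calc orderStat (Multiset.map (fun i => p i ω) I.val) (N (j + 1) - 1)
      ≤ p (σ ω ⟨j, hjs⟩) ω := by
        refine orderStat_le_of_lt_card_filter _ _ _ ?_
        rw [Multiset.filter_map, Multiset.card_map]
        change _ < (I.filter (fun i => p i ω ≤ p (σ ω ⟨j, hjs⟩) ω)).card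
        omega
    _ ≤ c (j + 1) := hp
    _ ≤ (N (j + 1) : ℝ) * α / (I.card : ℝ) := by
        have hj' : ((⌊γ * ((j + 1 : ℕ) : ℝ)⌋ : ℤ) : ℝ) + 1 = N (j + 1) := by exact_mod_cast hj
        have hcard : (I.card : ℝ) + j + 1 ≤ N (j + 1) + s := by exact_mod_cast hcardI
        rw [hc (j + 1) (by omega) (by omega), add_assoc (s : ℝ), hj']
        refine div_le_div_of_nonneg_left (mul_nonneg (Nat.cast_nonneg _) hα.1.le) hIpos ?_
        push_cast
        linarith
end

section
/- Let p̂_1, …, p̂_t be random variables in [0,1] with P{p̂_i ≤ u} ≤ u for all i and all u ∈ (0,1), with ordered values p̂_(1) ≤ ⋯ ≤ p̂_(t), and let 0 = β_0 ≤ β_1 ≤ ⋯ ≤ β_m ≤ 1 with m ≤ t. Then P{⋃_{i=1}^m {p̂_(i) ≤ β_i}} ≤ t · Σ_{i=1}^m (β_i − β_{i−1})/i. -/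
open MeasureTheory Set

/-- Abel summation against the weights `1 / i`. -/
lemma sum_Icc_sub_div_eq (β : ℕ → ℝ) (hβ0 : β 0 = 0) (m : ℕ) :
    ∑ i ∈ Finset.Icc 1 m, (β i - β (i - 1)) / (i : ℝ)
      = 1 / ((m : ℝ) + 1) * β m
        + ∑ i ∈ Finset.Icc 1 m, 1 / ((i : ℝ) * ((i : ℝ) + 1)) * β i := by
  induction m with
  | zero => simp [hβ0]
  | succ k ih =>
    rw [Finset.sum_Icc_succ_top (by omega), Finset.sum_Icc_succ_top (by omega), ih]
    have h1 : (k : ℝ) + 1 ≠ 0 := by positivity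
    have h2 : (k : ℝ) + 1 + 1 ≠ 0 := by positivity
    push_cast
    field_simp
    ring

/-- The tails of the telescoping series of `1 / (l (l + 1))`. -/
lemma one_div_add_sum_Icc_eq {i m : ℕ} (hi : 1 ≤ i) (him : i ≤ m) :
    1 / ((m : ℝ) + 1) + ∑ l ∈ Finset.Icc i m, 1 / ((l : ℝ) * ((l : ℝ) + 1)) = 1 / (i : ℝ) := by
  induction m, him using Nat.le_induction with
  | base =>
    have h1 : (i : ℝ) ≠ 0 := by positivity
    have h2 : (i : ℝ) + 1 ≠ 0 := by positivity
    rw [Finset.Icc_self, Finset.sum_singleton]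
    field_simp
  | succ k hk ih =>
    rw [Finset.sum_Icc_succ_top (by omega), ← ih]
    have h1 : (k : ℝ) + 1 ≠ 0 := by positivity
    have h2 : (k : ℝ) + 1 + 1 ≠ 0 := by positivity
    push_cast
    field_simp
    ring

/-- If a nonnegative sequence `N` is at least `i` on `[i, m]`, then its weighted sum over `[1, m]`
is at least one. -/
lemma one_le_weighted_sum {N : ℕ → ℝ} {i m : ℕ} (hN : ∀ l, 0 ≤ N l) (hi : 1 ≤ i) (him : i ≤ m)
    (hNi : ∀ l, i ≤ l → l ≤ m → (i : ℝ) ≤ N l) :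
    1 ≤ 1 / ((m : ℝ) + 1) * N m
      + ∑ l ∈ Finset.Icc 1 m, 1 / ((l : ℝ) * ((l : ℝ) + 1)) * N l := by
  have hi0 : (i : ℝ) ≠ 0 := by positivity
  calc (1 : ℝ) = (1 / ((m : ℝ) + 1) + ∑ l ∈ Finset.Icc i m, 1 / ((l : ℝ) * ((l : ℝ) + 1))) * i := by
        rw [one_div_add_sum_Icc_eq hi him]
        field_simp
    _ = 1 / ((m : ℝ) + 1) * i
          + ∑ l ∈ Finset.Icc i m, 1 / ((l : ℝ) * ((l : ℝ) + 1)) * i := by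
        rw [add_mul, Finset.sum_mul]
    _ ≤ 1 / ((m : ℝ) + 1) * N m
          + ∑ l ∈ Finset.Icc i m, 1 / ((l : ℝ) * ((l : ℝ) + 1)) * N l := by
        gcongr with l hl
        · exact hNi m him le_rfl
        · exact hNi l (Finset.mem_Icc.1 hl).1 (Finset.mem_Icc.1 hl).2
    _ ≤ _ := by
        gcongr
        intro l _ _
        have := hN l
        positivity

/-- If the `k`-th order statistic (0-indexed) is at most `b`, then at least `k + 1` elements are. -/
lemma lt_countP_of_orderStat_le {s : Multiset ℝ} {k : ℕ} {b : ℝ} (hk : k < s.card)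
    (h : orderStat s k ≤ b) : k < s.countP (· ≤ b) := by
  have hlen : k < (s.sort (· ≤ ·)).length := by simpa using hk
  rw [orderStat, List.getD_eq_getElem _ _ hlen] at h
  have htake : ((s.sort (· ≤ ·)).take (k + 1)).countP (· ≤ b) = k + 1 := by
    rw [List.countP_eq_length.2, List.length_take, min_eq_left hlen]
    intro x hx
    obtain ⟨n, hn, rfl⟩ := List.getElem_of_mem hx
    rw [List.length_take] at hn
    rw [List.getElem_take, decide_eq_true_eq]
    exact ((s.pairwise_sort (· ≤ ·)).sortedLE.getElem_le_getElem_of_le (by omega)).trans h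
  calc k < k + 1 := k.lt_succ_self
    _ ≤ (s.sort (· ≤ ·)).countP (· ≤ b) := htake ▸ (List.take_sublist _ _).countP_le
    _ = s.countP (· ≤ b) := by rw [← Multiset.coe_countP, Multiset.sort_eq]

/-- A stochastic domination bound on `(0, 1)` extends to `[0, 1]`. -/
lemma measure_le_ofReal_of_mem_Icc {Ω : Type*} [MeasurableSpace Ω] {P : Measure Ω}
    [IsProbabilityMeasure P] {X : Ω → ℝ}
    (hX : ∀ u ∈ Set.Ioo (0 : ℝ) 1, P {ω | X ω ≤ u} ≤ ENNReal.ofReal u)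
    {u : ℝ} (hu : u ∈ Set.Icc (0 : ℝ) 1) : P {ω | X ω ≤ u} ≤ ENNReal.ofReal u := by
  rcases hu.2.eq_or_lt with rfl | hu1
  · simpa using prob_le_one
  · have hcont : Filter.Tendsto ENNReal.ofReal (nhdsWithin u (Set.Ioi u))
        (nhds (ENNReal.ofReal u)) := ENNReal.continuous_ofReal.continuousWithinAt
    refine ge_of_tendsto hcont ?_
    filter_upwards [Ioo_mem_nhdsGT hu1] with v hv
    exact (measure_mono fun ω hω => le_trans hω hv.1.le).trans
      (hX v ⟨hu.1.trans_lt hv.1, hv.2⟩)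

/-- Lemma 3.1(i) of Lehmann–Romano (a generalization of Hommel's inequality): if
`P{p̂_i ≤ u} ≤ u` for all `i` and `u ∈ (0,1)`, and `0 = β_0 ≤ β_1 ≤ ⋯ ≤ β_m ≤ 1`
with `m ≤ t`, then
`P(⋃_{i=1}^m {p̂_(i) ≤ β_i}) ≤ t Σ_{i=1}^m (β_i − β_{i−1})/i`. -/
theorem hommel_type_bound
    {Ω : Type*} [MeasurableSpace Ω] (P : Measure Ω) [IsProbabilityMeasure P]
    (t : ℕ) (ht : 1 ≤ t) (phat : Fin t → Ω → ℝ)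
    (hmeas : ∀ i, Measurable (phat i)) (hrange : ∀ i ω, phat i ω ∈ Set.Icc (0:ℝ) 1)
    (hp : ∀ i, ∀ u ∈ Set.Ioo (0:ℝ) 1, P {ω | phat i ω ≤ u} ≤ ENNReal.ofReal u)
    (m : ℕ) (hm1 : 1 ≤ m) (hmt : m ≤ t)
    (β : ℕ → ℝ) (hβ0 : β 0 = 0) (hβmono : ∀ i < m, β i ≤ β (i + 1)) (hβ1 : β m ≤ 1) :
    P {ω | ∃ i, 1 ≤ i ∧ i ≤ m ∧
        orderStat (Multiset.map (fun idx => phat idx ω) Finset.univ.val) (i - 1) ≤ β i}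
      ≤ ENNReal.ofReal ((t : ℝ) * ∑ i ∈ Finset.Icc 1 m, (β i - β (i - 1)) / (i : ℝ)) := by
  have hmono : ∀ l k, l ≤ k → k ≤ m → β l ≤ β k := by
    intro l k hlk
    induction k, hlk using Nat.le_induction with
    | base => exact fun _ => le_rfl
    | succ k _ ih => exact fun hk => (ih (by omega)).trans (hβmono k (by omega))
  have hβpos : ∀ l ≤ m, 0 ≤ β l := fun l hl => hβ0 ▸ hmono 0 l l.zero_le hl
  set N : ℕ → Ω → ℝ := fun l ω => ((Finset.univ.filter fun j => phat j ω ≤ β l).card : ℝ) with hN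
  have hNsum : ∀ l ω, ENNReal.ofReal (N l ω)
      = ∑ j, {ω | phat j ω ≤ β l}.indicator (1 : Ω → ENNReal) ω := by
    intro l ω
    simp [hN, Set.indicator_apply, Finset.sum_boole]
  have hset : ∀ l j, MeasurableSet {ω | phat j ω ≤ β l} := fun l j =>
    measurableSet_le (hmeas j) measurable_const
  have hNmeas : ∀ l, Measurable fun ω => ENNReal.ofReal (N l ω) := by
    intro l
    simp_rw [hNsum]
    exact Finset.measurable_fun_sum _ fun j _ => measurable_one.indicator (hset l j)
  have hNint : ∀ l ≤ m, ∫⁻ ω, ENNReal.ofReal (N l ω) ∂P ≤ ENNReal.ofReal (t * β l) := by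
    intro l hl
    simp_rw [hNsum]
    rw [lintegral_finsetSum _ fun j _ => measurable_one.indicator (hset l j)]
    calc ∑ j, ∫⁻ ω, {ω | phat j ω ≤ β l}.indicator (1 : Ω → ENNReal) ω ∂P
        ≤ ∑ _j : Fin t, ENNReal.ofReal (β l) := by
          refine Finset.sum_le_sum fun j _ => ?_
          rw [lintegral_indicator_one (hset l j)]
          exact measure_le_ofReal_of_mem_Icc (hp j) ⟨hβpos l hl, (hmono l m hl le_rfl).trans hβ1⟩
      _ = ENNReal.ofReal (t * β l) := by
          rw [ENNReal.ofReal_mul (by positivity)]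
          simp
  set X : Ω → ENNReal := fun ω => ENNReal.ofReal (1 / ((m : ℝ) + 1)) * ENNReal.ofReal (N m ω)
    + ∑ l ∈ Finset.Icc 1 m,
        ENNReal.ofReal (1 / ((l : ℝ) * ((l : ℝ) + 1))) * ENNReal.ofReal (N l ω) with hX
  have hevent : {ω | ∃ i, 1 ≤ i ∧ i ≤ m ∧
      orderStat (Multiset.map (fun idx => phat idx ω) Finset.univ.val) (i - 1) ≤ β i}
      ⊆ {ω | 1 ≤ X ω} := by
    rintro ω ⟨i, hi, him, hord⟩
    have hcount := lt_countP_of_orderStat_le (by simp; omega) hord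
    rw [Multiset.countP_map] at hcount
    have hcard : i ≤ (Finset.univ.filter fun j => phat j ω ≤ β i).card := by
      change i - 1 < (Finset.univ.filter fun j => phat j ω ≤ β i).card at hcount
      omega
    have hge : (1 : ℝ) ≤ _ := one_le_weighted_sum (N := fun l => N l ω)
      (fun l => Nat.cast_nonneg _) hi him fun l hil hlm => by
        refine Nat.cast_le.2 (hcard.trans (Finset.card_le_card fun j hj => ?_))
        simp only [Finset.mem_filter, Finset.mem_univ, true_and] at hj ⊢
        exact hj.trans (hmono i l hil hlm)
    have hN0 : ∀ l, 0 ≤ N l ω := fun l => Nat.cast_nonneg _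
    change 1 ≤ X ω
    rw [← ENNReal.ofReal_one]
    refine (ENNReal.ofReal_le_ofReal hge).trans_eq ?_
    rw [ENNReal.ofReal_add (mul_nonneg (by positivity) (hN0 m))
        (Finset.sum_nonneg fun l _ => mul_nonneg (by positivity) (hN0 l)),
      ENNReal.ofReal_sum_of_nonneg fun l _ => mul_nonneg (by positivity) (hN0 l),
      ENNReal.ofReal_mul (by positivity)]
    exact congrArg _ (Finset.sum_congr rfl fun l _ => ENNReal.ofReal_mul (by positivity))
  have hXmeas : Measurable X :=
    ((hNmeas m).const_mul _).add (Finset.measurable_fun_sum _ fun l _ => (hNmeas l).const_mul _)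
  calc _ ≤ P {ω | 1 ≤ X ω} := measure_mono hevent
    _ ≤ ∫⁻ ω, X ω ∂P := by simpa using mul_meas_ge_le_lintegral hXmeas 1
    _ = ENNReal.ofReal (1 / ((m : ℝ) + 1)) * ∫⁻ ω, ENNReal.ofReal (N m ω) ∂P
        + ∑ l ∈ Finset.Icc 1 m, ENNReal.ofReal (1 / ((l : ℝ) * ((l : ℝ) + 1)))
            * ∫⁻ ω, ENNReal.ofReal (N l ω) ∂P := by
        rw [lintegral_add_left ((hNmeas m).const_mul _), lintegral_const_mul _ (hNmeas m),
          lintegral_finsetSum _ fun l _ => (hNmeas l).const_mul _]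
        exact congrArg _ (Finset.sum_congr rfl fun l _ => lintegral_const_mul _ (hNmeas l))
    _ ≤ ENNReal.ofReal (1 / ((m : ℝ) + 1)) * ENNReal.ofReal (t * β m)
        + ∑ l ∈ Finset.Icc 1 m, ENNReal.ofReal (1 / ((l : ℝ) * ((l : ℝ) + 1)))
            * ENNReal.ofReal (t * β l) := by
        gcongr with l hl
        · exact hNint m le_rfl
        · exact hNint l (Finset.mem_Icc.1 hl).2
    _ = _ := by
        have hnonneg : ∀ l ∈ Finset.Icc 1 m,
            0 ≤ 1 / ((l : ℝ) * ((l : ℝ) + 1)) * (t * β l) := fun l hl =>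
          mul_nonneg (by positivity)
            (mul_nonneg (by positivity) (hβpos l (Finset.mem_Icc.1 hl).2))
        have hsum : ∑ l ∈ Finset.Icc 1 m, ENNReal.ofReal (1 / ((l : ℝ) * ((l : ℝ) + 1)))
            * ENNReal.ofReal (t * β l)
            = ENNReal.ofReal (∑ l ∈ Finset.Icc 1 m,
                1 / ((l : ℝ) * ((l : ℝ) + 1)) * (t * β l)) := by
          rw [ENNReal.ofReal_sum_of_nonneg hnonneg]
          exact Finset.sum_congr rfl fun l _ => (ENNReal.ofReal_mul (by positivity)).symm
        rw [hsum, ← ENNReal.ofReal_mul (by positivity),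
          ← ENNReal.ofReal_add (mul_nonneg (by positivity)
            (mul_nonneg (by positivity) (hβpos m le_rfl))) (Finset.sum_nonneg hnonneg),
          sum_Icc_sub_div_eq β hβ0, mul_add, Finset.mul_sum]
        simp only [mul_left_comm]
end

section
/- Assume P{p_i ≤ u} ≤ u for every i ∈ I and every u ∈ (0,1), with no assumption on the joint distribution of the p-values. Then the stepdown procedure with constants α'_i = α_i / C_{⌊γs⌋+1}, where α_i = (⌊γi⌋ + 1)α / (s + ⌊γi⌋ + 1 − i) and C_j = Σ_{i=1}^j 1/i, satisfies P{FDP > γ} ≤ α. -/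
open MeasureTheory Set

/-- Telescoping of the weights `1 / (k (k + 1))`, closed off by the final weight `1 / M`. -/
lemma sum_Ico_inv_mul_succ_add_inv {m M : ℕ} (hm : 1 ≤ m) (hmM : m ≤ M) :
    ∑ k ∈ Finset.Ico m M, (1 : ℝ) / (k * (k + 1)) + 1 / M = 1 / m := by
  induction M, hmM using Nat.le_induction with
  | base => simp
  | succ n hn ih =>
    rw [Finset.sum_Ico_succ_top hn, ← ih, add_assoc]
    have : (0 : ℝ) < n := by exact_mod_cast hm.trans hn
    congr 1
    push_cast
    field_simp
    ring

lemma sum_Ico_inv_succ_add_one {M : ℕ} (hM : 1 ≤ M) :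
    ∑ k ∈ Finset.Ico 1 M, (1 : ℝ) / (k + 1) + 1 = ∑ j ∈ Finset.Icc 1 M, (1 : ℝ) / j := by
  induction M, hM using Nat.le_induction with
  | base => simp
  | succ n hn ih =>
    rw [Finset.sum_Ico_succ_top hn, Finset.sum_Icc_succ_top (by omega), ← ih]
    push_cast
    ring

/-- A Hommel-type inequality: for superuniform `q i`, whatever their joint distribution, the
probability that for some `m ≤ M` at least `m` of them are at most `m * δ` is bounded by
`#I * δ * (1 + 1 / 2 + ⋯ + 1 / M)`. -/
lemma measure_exists_le_card_le {Ω ι : Type*} [MeasurableSpace Ω] (P : Measure Ω)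
    [IsProbabilityMeasure P] (I : Finset ι) (q : ι → Ω → ℝ) (hq : ∀ i, Measurable (q i))
    (hI : ∀ i ∈ I, ∀ u ∈ Set.Ioo (0 : ℝ) 1, P {ω | q i ω ≤ u} ≤ ENNReal.ofReal u)
    {M : ℕ} (hM : 1 ≤ M) {δ : ℝ} (hδ : 0 < δ) :
    P {ω | ∃ m : ℕ, 1 ≤ m ∧ m ≤ M ∧ m ≤ (I.filter fun i => q i ω ≤ m * δ).card} ≤
      ENNReal.ofReal (I.card * δ * ∑ j ∈ Finset.Icc 1 M, (1 : ℝ) / j) := by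
  classical
  have hbound : ∀ k : ℕ, 1 ≤ k → ∀ i ∈ I, P.real {ω | q i ω ≤ k * δ} ≤ k * δ := by
    intro k hk i hi
    have hpos : 0 < (k : ℝ) * δ := by positivity
    rcases lt_or_ge ((k : ℝ) * δ) 1 with h | h
    · exact ENNReal.toReal_le_of_le_ofReal hpos.le (hI i hi _ ⟨hpos, h⟩)
    · exact measureReal_le_one.trans h
  have hset : ∀ (k : ℕ) i, MeasurableSet {ω | q i ω ≤ k * δ} := fun k i =>
    measurableSet_le (hq i) measurable_const
  let a : ℕ → Ω → ℝ := fun k ω => ∑ i ∈ I, {ω | q i ω ≤ k * δ}.indicator (fun _ => (1 : ℝ)) ω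
  have ha_card : ∀ k ω, a k ω = ((I.filter fun i => q i ω ≤ k * δ).card : ℝ) := by
    intro k ω
    simp [a, Set.indicator_apply, Finset.sum_boole]
  have ha_nonneg : ∀ k ω, 0 ≤ a k ω := fun k ω => by rw [ha_card]; positivity
  have ha_mono : ∀ {k l : ℕ}, k ≤ l → ∀ ω, a k ω ≤ a l ω := by
    intro k l hkl ω
    rw [ha_card, ha_card]
    have : (k : ℝ) * δ ≤ l * δ := by gcongr
    exact_mod_cast Finset.card_le_card
      (Finset.monotone_filter_right I fun i _ hi => le_trans hi this)
  have hind_int : ∀ (k : ℕ) i, Integrable ({ω | q i ω ≤ k * δ}.indicator (fun _ => (1 : ℝ))) P :=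
    fun k i => (integrable_const _).indicator (hset k i)
  have ha_int : ∀ k, Integrable (a k) P := fun k => integrable_finsetSum _ fun i _ => hind_int k i
  have ha_le : ∀ k : ℕ, 1 ≤ k → ∫ ω, a k ω ∂P ≤ I.card * (k * δ) := by
    intro k hk
    rw [integral_finsetSum _ fun i _ => hind_int k i, ← nsmul_eq_mul I.card,
      ← Finset.sum_const]
    refine Finset.sum_le_sum fun i hi => ?_
    rw [integral_indicator_const _ (hset k i)]
    simpa using hbound k hk i hi
  let f : Ω → ℝ := fun ω => ∑ k ∈ Finset.Ico 1 M, 1 / ((k : ℝ) * (k + 1)) * a k ω + 1 / M * a M ω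
  have hsum_int : Integrable (fun ω => ∑ k ∈ Finset.Ico 1 M, 1 / ((k : ℝ) * (k + 1)) * a k ω) P :=
    integrable_finsetSum _ fun k _ => (ha_int k).const_mul _
  have hf_int : Integrable f P := hsum_int.add ((ha_int M).const_mul _)
  have hf_nonneg : ∀ ω, 0 ≤ f ω := fun ω =>
    add_nonneg (Finset.sum_nonneg fun k _ => mul_nonneg (by positivity) (ha_nonneg k ω))
      (mul_nonneg (by positivity) (ha_nonneg M ω))
  have hM0 : (0 : ℝ) < M := by exact_mod_cast hM
  have hf_le : ∫ ω, f ω ∂P ≤ I.card * δ * ∑ j ∈ Finset.Icc 1 M, (1 : ℝ) / j := by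
    rw [integral_add hsum_int ((ha_int M).const_mul _),
      integral_finsetSum _ fun k _ => (ha_int k).const_mul _, ← sum_Ico_inv_succ_add_one hM,
      mul_add, Finset.mul_sum]
    refine add_le_add (Finset.sum_le_sum fun k hk => ?_) ?_
    · have hk1 := (Finset.mem_Ico.1 hk).1
      have hk0 : (0 : ℝ) < k := by exact_mod_cast hk1
      rw [integral_const_mul]
      calc _ ≤ 1 / ((k : ℝ) * (k + 1)) * (I.card * (k * δ)) := by gcongr; exact ha_le k hk1
        _ = _ := by field_simp
    · rw [integral_const_mul]
      calc _ ≤ 1 / (M : ℝ) * (I.card * (M * δ)) := by gcongr; exact ha_le M hM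
        _ = _ := by field_simp
  have hsub : {ω | ∃ m : ℕ, 1 ≤ m ∧ m ≤ M ∧ m ≤ (I.filter fun i => q i ω ≤ m * δ).card} ⊆
      {ω | 1 ≤ f ω} := by
    rintro ω ⟨m, hm, hmM, hcard⟩
    have hm0 : (0 : ℝ) < m := by exact_mod_cast hm
    have ham : (m : ℝ) ≤ a m ω := by rw [ha_card]; exact_mod_cast hcard
    calc (1 : ℝ) = (∑ k ∈ Finset.Ico m M, (1 : ℝ) / (k * (k + 1)) + 1 / M) * m := by
          rw [sum_Ico_inv_mul_succ_add_inv hm hmM]; field_simp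
      _ = ∑ k ∈ Finset.Ico m M, (1 : ℝ) / (k * (k + 1)) * m + 1 / M * m := by
          rw [add_mul, Finset.sum_mul]
      _ ≤ ∑ k ∈ Finset.Ico m M, (1 : ℝ) / (k * (k + 1)) * a k ω + 1 / M * a M ω := by
          gcongr with k hk
          · exact ham.trans (ha_mono (Finset.mem_Ico.1 hk).1 ω)
          · exact ham.trans (ha_mono hmM ω)
      _ ≤ f ω := by
          refine add_le_add_left (Finset.sum_le_sum_of_subset_of_nonneg
            (Finset.Ico_subset_Ico_left hm) fun k _ _ => ?_) _
          exact mul_nonneg (by positivity) (ha_nonneg k ω)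
  refine (measure_mono hsub).trans ?_
  rw [← ofReal_measureReal]
  refine ENNReal.ofReal_le_ofReal (le_trans ?_ hf_le)
  simpa using mul_meas_ge_le_integral_of_nonneg (ae_of_all _ hf_nonneg) hf_int 1

/-- If the proportion of marked points among the first `r` exceeds `γ`, then at the first `j` where
this happens exactly `⌊γ j⌋ + 1` of the first `j` points are marked. -/
lemma exists_card_filter_lt_eq_floor_add_one {s : ℕ} (A : Finset (Fin s)) {γ : ℝ} (hγ : 0 ≤ γ)
    {r : ℕ} (hr : γ * r < ((A.filter fun i => i.val < r).card : ℝ)) :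
    ∃ j, 1 ≤ j ∧ j ≤ r ∧ (A.filter fun i => i.val < j).card = ⌊γ * j⌋₊ + 1 := by
  classical
  have hex : ∃ j : ℕ, γ * j < ((A.filter fun i => i.val < j).card : ℝ) := ⟨r, hr⟩
  have hlt := Nat.find_spec hex
  have hmin := fun k => Nat.find_min (m := k) hex
  have hle := Nat.find_min' hex hr
  generalize Nat.find hex = j at hlt hmin hle
  obtain _ | n := j
  · simp at hlt
  refine ⟨n + 1, by omega, hle, le_antisymm ?_ ?_⟩
  · have hn : ((A.filter fun i => i.val < n).card : ℝ) ≤ γ * n := not_lt.1 (hmin n (by omega))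
    have hn' : (A.filter fun i => i.val < n).card ≤ ⌊γ * (n + 1 : ℕ)⌋₊ :=
      Nat.le_floor (hn.trans (by gcongr; omega))
    have hsplit : (A.filter fun i => i.val < n + 1) ⊆
        (A.filter fun i => i.val < n) ∪ (Finset.univ.filter fun i : Fin s => i.val = n) := by
      intro i
      simp only [Finset.mem_filter, Finset.mem_union, Finset.mem_univ, true_and]
      intro h
      by_cases hi : i.val = n
      · exact Or.inr hi
      · exact Or.inl ⟨h.1, by omega⟩
    have hone : (Finset.univ.filter fun i : Fin s => i.val = n).card ≤ 1 :=
      Finset.card_le_one.2 fun x hx y hy => Fin.ext <| by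
        rw [(Finset.mem_filter.1 hx).2, (Finset.mem_filter.1 hy).2]
    have := (Finset.card_le_card hsplit).trans (Finset.card_union_le _ _)
    omega
  · exact Nat.succ_le_of_lt ((Nat.floor_lt (by positivity)).2 hlt)

/-- An initial segment of `Fin s` is determined by its cardinality. -/
lemma mem_of_val_lt_card {s : ℕ} {A : Finset (Fin s)} (hA : ∀ i j, i ≤ j → j ∈ A → i ∈ A)
    {i : Fin s} (hi : i.val < A.card) : i ∈ A := by
  by_contra h
  have hsub : A ⊆ Finset.Iio i := fun j hj =>
    Finset.mem_Iio.2 (lt_of_not_ge fun hij => h (hA i j hij hj))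
  have := Finset.card_le_card hsub
  rw [Fin.card_Iio] at this
  omega

/-- Theorem 3.3 of Lehmann–Romano: under no dependence assumptions (only that each
true-null p-value is stochastically dominated by the uniform), the stepdown procedure
with constants `α'_i = α_i / C_{⌊γ s⌋+1}`, where
`α_i = (⌊γ i⌋ + 1)α/(s + ⌊γ i⌋ + 1 − i)` and `C_j = Σ_{i=1}^j 1/i`, satisfies
`P{FDP > γ} ≤ α`. -/
theorem stepdown_controls_FDP_no_dependence
    {Ω : Type*} [MeasurableSpace Ω] (P : Measure Ω) [IsProbabilityMeasure P]
    (s : ℕ) (hs : 1 ≤ s) (p : Fin s → Ω → ℝ)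
    (hmeas : ∀ i, Measurable (p i)) (hrange : ∀ i ω, p i ω ∈ Set.Icc (0:ℝ) 1)
    (I : Finset (Fin s)) (γ α : ℝ) (hγ : γ ∈ Set.Ioo (0:ℝ) 1) (hα : α ∈ Set.Ioo (0:ℝ) 1)
    (hI : ∀ i ∈ I, ∀ u ∈ Set.Ioo (0:ℝ) 1, P {ω | p i ω ≤ u} ≤ ENNReal.ofReal u)
    (c : ℕ → ℝ)
    (hc : ∀ i, 1 ≤ i → i ≤ s →
      c i = ((((⌊γ * (i : ℝ)⌋ : ℤ) : ℝ) + 1) * α /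
          ((s : ℝ) + ((⌊γ * (i : ℝ)⌋ : ℤ) : ℝ) + 1 - (i : ℝ))) /
        (∑ j ∈ Finset.Icc 1 (⌊γ * (s : ℝ)⌋₊ + 1), (1 : ℝ) / (j : ℝ)))
    (σ : Ω → Equiv.Perm (Fin s))
    (hσmono : ∀ ω, Monotone fun i => p (σ ω i) ω)
    (hσmeas : ∀ i : Fin s, Measurable fun ω => σ ω i)
    (R : Ω → ℕ)
    (hR : ∀ ω, R ω = (Finset.univ.filter
      (fun r : Fin s => ∀ i : Fin s, i ≤ r → p (σ ω i) ω ≤ c (i.val + 1))).card)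
    (F : Ω → ℕ)
    (hF : ∀ ω, F ω = (Finset.univ.filter
      (fun i : Fin s => i.val < R ω ∧ σ ω i ∈ I)).card) :
    P {ω | γ < (F ω : ℝ) / (R ω : ℝ)} ≤ ENNReal.ofReal α := by
  classical
  obtain ⟨hγ0, -⟩ := hγ
  obtain ⟨hα0, -⟩ := hα
  set M : ℕ := ⌊γ * (s : ℝ)⌋₊ + 1 with hM
  set C : ℝ := ∑ j ∈ Finset.Icc 1 M, (1 : ℝ) / (j : ℝ) with hC
  have hM1 : 1 ≤ M := by omega
  have hCpos : 0 < C := Finset.sum_pos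
    (fun j hj => by
      have : (0 : ℝ) < j := by exact_mod_cast (Finset.mem_Icc.1 hj).1
      positivity) ⟨1, Finset.mem_Icc.2 ⟨le_rfl, hM1⟩⟩
  rcases I.eq_empty_or_nonempty with hI0 | hIne
  · have : {ω | γ < (F ω : ℝ) / (R ω : ℝ)} = ∅ := by
      ext ω
      simp [hF, hI0, hγ0.le]
    simp [this]
  have hIpos : (0 : ℝ) < I.card := by exact_mod_cast hIne.card_pos
  have hδ : 0 < α / (I.card * C) := by positivity
  have key := measure_exists_le_card_le P I p hmeas hI hM1 hδ
  rw [← hC, show (I.card : ℝ) * (α / (I.card * C)) * C = α by field_simp] at key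
  refine (measure_mono fun ω hω => ?_).trans key
  have hω' : γ < (F ω : ℝ) / (R ω : ℝ) := hω
  have hRpos : (0 : ℝ) < R ω := by
    rcases (Nat.cast_nonneg (α := ℝ) (R ω)).eq_or_lt with h | h
    · rw [← h, div_zero] at hω'
      exact absurd hω' hγ0.not_gt
    · exact h
  rw [lt_div_iff₀ hRpos] at hω'
  have hFR : F ω = ((Finset.univ.filter fun i => σ ω i ∈ I).filter
      fun i : Fin s => i.val < R ω).card := by
    rw [hF, Finset.filter_filter]
    simp only [and_comm]
  rw [hFR] at hω'
  obtain ⟨j, hj1, hjR, hj⟩ := exists_card_filter_lt_eq_floor_add_one _ hγ0.le hω'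
  have hRs : R ω ≤ s := by
    rw [hR]
    exact (Finset.card_le_univ _).trans_eq (Fintype.card_fin s)
  have hjs : j ≤ s := hjR.trans hRs
  have hfloor : ((⌊γ * (j : ℝ)⌋ : ℤ) : ℝ) = (⌊γ * (j : ℝ)⌋₊ : ℝ) :=
    (natCast_floor_eq_intCast_floor (by positivity)).symm
  set m : ℕ := ⌊γ * (j : ℝ)⌋₊ + 1 with hm
  have hcount : I.card + j ≤ s + m := by
    have hdisj : Disjoint (Finset.univ.filter fun i => σ ω i ∈ I)
        (Finset.univ.filter fun i : Fin s => i.val < j ∧ σ ω i ∉ I) := by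
      rw [Finset.disjoint_filter]
      exact fun i _ h h' => h'.2 h
    have h1 := Finset.card_union_of_disjoint hdisj ▸ Finset.card_le_univ
      ((Finset.univ.filter fun i => σ ω i ∈ I) ∪
        (Finset.univ.filter fun i : Fin s => i.val < j ∧ σ ω i ∉ I))
    have h2 : (Finset.univ.filter fun i => σ ω i ∈ I).card = I.card :=
      Finset.card_bij (fun i _ => σ ω i) (by simp) (by simp)
        (fun b hb => ⟨(σ ω).symm b, by simpa using hb, by simp⟩)
    have h3 := Finset.card_filter_add_card_filter_not
      (s := Finset.univ.filter fun i : Fin s => i.val < j) (fun i => σ ω i ∈ I)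
    rw [Finset.filter_filter, Finset.filter_filter, Fin.card_filter_val_lt] at h3
    rw [Finset.filter_filter] at hj
    simp only [and_comm] at hj h3 h1
    rw [Fintype.card_fin] at h1
    simp only [min_eq_right hjs] at h3
    omega
  have hcj : c j ≤ m * (α / (I.card * C)) := by
    have hcount' : (I.card : ℝ) ≤ s + m - j := by
      have : (I.card : ℝ) + j ≤ s + m := by exact_mod_cast hcount
      linarith
    have hmR : (m : ℝ) = (⌊γ * (j : ℝ)⌋₊ : ℝ) + 1 := by rw [hm]; push_cast; rfl
    rw [hc j hj1 hjs, hfloor, ← hmR, add_assoc (s : ℝ), ← hmR]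
    calc m * α / (s + m - j) / C ≤ m * α / I.card / C := by gcongr
      _ = _ := by field_simp
  refine ⟨m, by omega, ?_, ?_⟩
  · have : ⌊γ * (j : ℝ)⌋₊ ≤ ⌊γ * (s : ℝ)⌋₊ := Nat.floor_le_floor (by gcongr)
    omega
  · refine hj.ge.trans (Finset.card_le_card_of_injOn (σ ω) (fun i hi => ?_)
      (σ ω).injective.injOn)
    simp only [Finset.coe_filter, Finset.mem_filter, Finset.mem_univ, true_and,
      Set.mem_ofPred_eq] at hi ⊢
    refine ⟨hi.1, le_trans ?_ hcj⟩
    have hlast : p (σ ω ⟨j - 1, by omega⟩) ω ≤ c j := by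
      have hmem := mem_of_val_lt_card (A := Finset.univ.filter
          (fun r : Fin s => ∀ i : Fin s, i ≤ r → p (σ ω i) ω ≤ c (i.val + 1)))
        (fun i k hik hk => by
          simp only [Finset.mem_filter, Finset.mem_univ, true_and] at hk ⊢
          exact fun l hl => hk l (hl.trans hik))
        (i := ⟨j - 1, by omega⟩) (by rw [← hR]; simp only; omega)
      have := (Finset.mem_filter.1 hmem).2 _ le_rfl
      simpa [Nat.sub_add_cancel hj1] using this
    exact (hσmono ω (Fin.le_def.2 (by simp only; omega))).trans hlast
end
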